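/- arXiv:2106.01937 — 3 statements merged into one kernel-verified Lean document; each statement's English description precedes it below -/
import Mathlib

section
/- Let d ≥ 2 and m ≥ 2. Let Ω be the jittered partition of [0,1]^d into m^d congruent axis-aligned cubes of side 1/m, and let Ω̃ be the partition obtained from Ω by replacing the two cubes whose union is I = [1−2/m, 1] × [1−1/m, 1]^{d−1} by the two triangular prisms Ω̃_1 = {(x_1,x_2) ∈ I' : x_2 ≤ 1 − m(x_1 − (1−2/m))/2·(1/m) }, i.e. the prism over the triangle conv{(1−2/m,1−1/m), (1,1−1/m), (1−2/m,1)} times ∏_{i=3}^d [1−1/m, 1], and its complementary prism in I. Then E L2²(P_Ω) − E L2²(P_Ω̃) = (2/5)·3^{−d}·m^{−3d} > 0. -/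
open MeasureTheory ProbabilityTheory

noncomputable section

namespace StratifiedSampling

variable {d : ℕ} {ι : Type} [Fintype ι]

/-- Lebesgue volume of a subset of `ℝ^d` as a real number. -/
def vol (s : Set (Fin d → ℝ)) : ℝ := (volume s).toReal

/-- Number of points of the configuration `p` that lie in the lower box `(-∞, x]`. -/
def countIn (p : ι → (Fin d → ℝ)) (x : Fin d → ℝ) : ℝ :=
  ∑ i, Set.indicator (Set.Iic x) (fun _ => (1 : ℝ)) (p i)

/-- Discrepancy function of the point configuration `p` in the set `K`:
`d_P(x) = #(P ∩ (-∞,x])/N − |K ∩ (-∞,x]|/|K|`. -/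
def discrep (K : Set (Fin d → ℝ)) (p : ι → (Fin d → ℝ)) (x : Fin d → ℝ) : ℝ :=
  countIn p x / (Fintype.card ι : ℝ) - vol (K ∩ Set.Iic x) / vol K

/-- Joint distribution of the stratified sample associated with the family `Ω`:
the points are independent and the `i`-th point is uniformly distributed on `Ω i`. -/
def stratDist (Ω : ι → Set (Fin d → ℝ)) : Measure (ι → (Fin d → ℝ)) :=
  Measure.pi fun i => ProbabilityTheory.cond volume (Ω i)

/-- Mean squared `L2`-discrepancy of the stratified sample from the family `Ω` in `K`:
`E L2²(P_Ω) = E[(1/|K|) ∫_K d_{P_Ω}(x)² dx]`. -/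
def meanL2sq (K : Set (Fin d → ℝ)) (Ω : ι → Set (Fin d → ℝ)) : ℝ :=
  ∫ p, ((1 / vol K) * ∫ x in K, (discrep K p x) ^ 2) ∂(stratDist Ω)

/-- `Ω` is a partition of `K`: measurable sets of positive volume whose union
is `K` and whose distinct members have disjoint interiors. -/
structure IsPartition (K : Set (Fin d → ℝ)) (Ω : ι → Set (Fin d → ℝ)) : Prop where
  measurableSet : ∀ i, MeasurableSet (Ω i)
  vol_pos : ∀ i, 0 < volume (Ω i)
  iUnion_eq : (⋃ i, Ω i) = K
  disjoint_interiors : ∀ i j, i ≠ j → interior (Ω i) ∩ interior (Ω j) = ∅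

/-- All members of `Ω` have the same volume. -/
def IsEquivolume (Ω : ι → Set (Fin d → ℝ)) : Prop :=
  ∀ i j, volume (Ω i) = volume (Ω j)

/-- `q_i(x) = |Ω_i ∩ (-∞,x]| / |Ω_i|`. -/
def qfun (Ω : ι → Set (Fin d → ℝ)) (i : ι) (x : Fin d → ℝ) : ℝ :=
  vol (Ω i ∩ Set.Iic x) / vol (Ω i)

end StratifiedSampling

namespace StratifiedSampling

/-- The jittered cube with multi-index `j`: `∏_k [j_k/m, (j_k+1)/m]`. -/
def jitteredCube {d : ℕ} (m : ℕ) (j : Fin d → Fin m) : Set (Fin d → ℝ) :=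
  Set.Icc (fun k => (j k : ℝ) / m) (fun k => ((j k : ℝ) + 1) / m)

/-- The lower triangular prism: prism over the triangle
`conv{(1−2/m, 1−1/m), (1, 1−1/m), (1−2/m, 1)}` times `∏_{i=3}^d [1−1/m, 1]`. -/
def prismA (d m : ℕ) (hd : 2 ≤ d) : Set (Fin d → ℝ) :=
  {x | ![x ⟨0, by omega⟩, x ⟨1, by omega⟩] ∈
      convexHull ℝ {![1 - 2 / (m : ℝ), 1 - 1 / (m : ℝ)], ![1, 1 - 1 / (m : ℝ)],
        ![1 - 2 / (m : ℝ), 1]} ∧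
    ∀ k : Fin d, 2 ≤ (k : ℕ) → (1 - 1 / (m : ℝ) ≤ x k ∧ x k ≤ 1)}

/-- The complementary triangular prism in `I`: prism over the triangle
`conv{(1, 1−1/m), (1−2/m, 1), (1, 1)}` times `∏_{i=3}^d [1−1/m, 1]`. -/
def prismB (d m : ℕ) (hd : 2 ≤ d) : Set (Fin d → ℝ) :=
  {x | ![x ⟨0, by omega⟩, x ⟨1, by omega⟩] ∈
      convexHull ℝ {![1, 1 - 1 / (m : ℝ)], ![1 - 2 / (m : ℝ), 1], ![(1 : ℝ), 1]} ∧
    ∀ k : Fin d, 2 ≤ (k : ℕ) → (1 - 1 / (m : ℝ) ≤ x k ∧ x k ≤ 1)}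

/-- Multi-index of the jittered cube `[1−2/m, 1−1/m] × [1−1/m, 1]^{d−1}`. -/
def idxA (d m : ℕ) (hm : 2 ≤ m) : Fin d → Fin m :=
  fun k => if (k : ℕ) = 0 then ⟨m - 2, by omega⟩ else ⟨m - 1, by omega⟩

/-- Multi-index of the jittered cube `[1−1/m, 1]^d`. -/
def idxB (d m : ℕ) (hm : 2 ≤ m) : Fin d → Fin m :=
  fun _ => ⟨m - 1, by omega⟩

variable {d : ℕ} {ι : Type} [Fintype ι]


/-- A sampling cell: a measurable set of positive and finite volume. -/
structure IsCell (s : Set (Fin d → ℝ)) : Prop where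
  measurableSet : MeasurableSet s
  vol_ne_zero : volume s ≠ 0
  vol_ne_top : volume s ≠ ⊤

lemma IsCell.isProbabilityMeasure {s : Set (Fin d → ℝ)} (hs : IsCell s) :
    IsProbabilityMeasure (ProbabilityTheory.cond volume s) :=
  cond_isProbabilityMeasure_of_finite hs.vol_ne_zero hs.vol_ne_top

lemma measurable_indicator_Iic (x : Fin d → ℝ) :
    Measurable ((Set.Iic x).indicator (fun _ => (1 : ℝ))) :=
  measurable_const.indicator measurableSet_Iic

lemma memLp_indicator_Iic (x : Fin d → ℝ) (μ : Measure (Fin d → ℝ)) [IsFiniteMeasure μ] :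
    MemLp ((Set.Iic x).indicator (fun _ => (1 : ℝ))) 2 μ :=
  (memLp_const 1).indicator measurableSet_Iic

lemma integral_indicator_cond {s : Set (Fin d → ℝ)} (hs : IsCell s) (x : Fin d → ℝ) :
    ∫ y, (Set.Iic x).indicator (fun _ => (1 : ℝ)) y ∂(ProbabilityTheory.cond volume s) =
      vol (s ∩ Set.Iic x) / vol s := by
  rw [integral_indicator_const _ measurableSet_Iic, measureReal_def, cond_apply hs.measurableSet]
  simp [vol, ENNReal.toReal_mul, ENNReal.toReal_inv, div_eq_inv_mul]

lemma variance_indicator_cond {s : Set (Fin d → ℝ)} (hs : IsCell s) (x : Fin d → ℝ) :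
    Var[(Set.Iic x).indicator (fun _ => (1 : ℝ)); ProbabilityTheory.cond volume s] =
      vol (s ∩ Set.Iic x) / vol s - (vol (s ∩ Set.Iic x) / vol s) ^ 2 := by
  have := hs.isProbabilityMeasure
  rw [variance_eq_sub (memLp_indicator_Iic x _), integral_indicator_cond hs]
  congr 1
  rw [← integral_indicator_cond hs]
  congr 1
  ext y
  by_cases hy : y ∈ Set.Iic x <;> simp [Set.indicator, hy]

/-- Second moment of the discrepancy at a fixed point, as variance plus squared bias. -/
lemma integral_sq_discrep [Nonempty ι] {Ω : ι → Set (Fin d → ℝ)} (hΩ : ∀ i, IsCell (Ω i))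
    (K : Set (Fin d → ℝ)) (x : Fin d → ℝ) :
    ∫ p, (discrep K p x) ^ 2 ∂(stratDist Ω) =
      (∑ i, (qfun Ω i x - qfun Ω i x ^ 2)) / (Fintype.card ι : ℝ) ^ 2 +
        ((∑ i, qfun Ω i x) / (Fintype.card ι : ℝ) - vol (K ∩ Set.Iic x) / vol K) ^ 2 := by
  have := fun i => (hΩ i).isProbabilityMeasure
  have hprob : IsProbabilityMeasure (stratDist Ω) := by unfold stratDist; infer_instance
  have hmem : ∀ i : ι, MemLp (fun p : ι → (Fin d → ℝ) =>
      (Set.Iic x).indicator (fun _ => (1 : ℝ)) (p i)) 2 (stratDist Ω) := fun i =>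
    (memLp_indicator_Iic x _).comp_measurePreserving
      (measurePreserving_eval (fun i => ProbabilityTheory.cond volume (Ω i)) i)
  have hcount : MemLp (fun p : ι → (Fin d → ℝ) => countIn p x) 2 (stratDist Ω) :=
    memLp_finsetSum _ fun i _ => hmem i
  have hmean : ∫ p, countIn p x ∂(stratDist Ω) = ∑ i, qfun Ω i x := by
    unfold countIn
    rw [integral_finsetSum _ fun i _ => (hmem i).integrable (by norm_num)]
    refine Finset.sum_congr rfl fun i _ => ?_
    rw [qfun, ← integral_indicator_cond (hΩ i), stratDist]
    exact integral_comp_eval (μ := fun i => ProbabilityTheory.cond volume (Ω i))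
      (measurable_indicator_Iic x).aestronglyMeasurable
  have hvar : Var[fun p => countIn p x; stratDist Ω] =
      ∑ i, (qfun Ω i x - qfun Ω i x ^ 2) := by
    have h := variance_sum_pi (μ := fun i => ProbabilityTheory.cond volume (Ω i))
      (X := fun _ => (Set.Iic x).indicator (fun _ => (1 : ℝ)))
      (fun i => memLp_indicator_Iic x _)
    have h2 : (fun p : ι → (Fin d → ℝ) => countIn p x) =
        ∑ i, fun p : ι → (Fin d → ℝ) => (Set.Iic x).indicator (fun _ => (1 : ℝ)) (p i) := by
      ext p; simp [countIn]
    rw [h2, stratDist, h]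
    exact Finset.sum_congr rfl fun i _ => variance_indicator_cond (hΩ i) x
  have hdisc : MemLp (fun p : ι → (Fin d → ℝ) => discrep K p x) 2 (stratDist Ω) := by
    have := (hcount.mul_const (Fintype.card ι : ℝ)⁻¹).sub
      (memLp_const (vol (K ∩ Set.Iic x) / vol K))
    simp only [discrep, div_eq_mul_inv]
    exact this
  have key := variance_eq_sub hdisc
  have hv2 : Var[fun p => discrep K p x; stratDist Ω] =
      (∑ i, (qfun Ω i x - qfun Ω i x ^ 2)) / (Fintype.card ι : ℝ) ^ 2 := by
    simp only [discrep, div_eq_mul_inv]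
    rw [variance_sub_const (by exact (hcount.mul_const _).aestronglyMeasurable),
      variance_mul_const, hvar, inv_pow]
  have hm2 : ∫ p, discrep K p x ∂(stratDist Ω) =
      (∑ i, qfun Ω i x) / (Fintype.card ι : ℝ) - vol (K ∩ Set.Iic x) / vol K := by
    simp only [discrep]
    rw [integral_sub ((hcount.integrable (by norm_num)).div_const _) (integrable_const _),
      integral_div, hmean]
    simp
  rw [hv2, hm2] at key
  simp only [Pi.pow_apply] at key
  linarith

lemma measurable_vol_inter_Iic {K : Set (Fin d → ℝ)} (hK : MeasurableSet K) (hK' : volume K ≠ ⊤) :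
    Measurable fun x : Fin d → ℝ => vol (K ∩ Set.Iic x) := by
  have : IsFiniteMeasure (volume.restrict K) := isFiniteMeasure_restrict.2 hK'
  have hms : MeasurableSet {q : (Fin d → ℝ) × (Fin d → ℝ) | q.2 ≤ q.1} :=
    measurableSet_le measurable_snd measurable_fst
  have h := (measurable_measure_prodMk_left (ν := volume.restrict K) hms).ennreal_toReal
  convert h using 1
  ext x
  rw [vol, Measure.restrict_apply' hK, Set.inter_comm]
  rfl

lemma measurable_discrep {K : Set (Fin d → ℝ)} (hK : MeasurableSet K) (hK' : volume K ≠ ⊤) :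
    Measurable fun q : (ι → (Fin d → ℝ)) × (Fin d → ℝ) => discrep K q.1 q.2 := by
  refine Measurable.sub (Measurable.div_const ?_ _) (Measurable.div_const ?_ _)
  · refine Finset.measurable_sum _ fun i _ => ?_
    have hms : MeasurableSet {q : (ι → (Fin d → ℝ)) × (Fin d → ℝ) | q.1 i ≤ q.2} :=
      measurableSet_le ((measurable_pi_apply i).comp measurable_fst) measurable_snd
    exact (measurable_const (a := (1 : ℝ))).indicator hms
  · exact (measurable_vol_inter_Iic hK hK').comp measurable_snd

lemma abs_discrep_le_one (K : Set (Fin d → ℝ)) (hK : volume K ≠ ⊤)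
    (p : ι → (Fin d → ℝ)) (x : Fin d → ℝ) : |discrep K p x| ≤ 1 := by
  have h1 : 0 ≤ countIn p x := Finset.sum_nonneg fun i _ =>
    Set.indicator_nonneg (fun _ _ => zero_le_one) _
  have h2 : countIn p x ≤ Fintype.card ι := by
    have : countIn p x ≤ ∑ _i : ι, (1 : ℝ) := Finset.sum_le_sum fun i _ =>
      Set.indicator_le_self' (fun _ _ => zero_le_one) _
    simpa using this
  have h3 : 0 ≤ vol (K ∩ Set.Iic x) := ENNReal.toReal_nonneg
  have h4 : vol (K ∩ Set.Iic x) ≤ vol K :=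
    ENNReal.toReal_mono hK (measure_mono Set.inter_subset_left)
  have h5 := div_le_one_of_le₀ h2 (Nat.cast_nonneg _)
  have h6 := div_le_one_of_le₀ h4 ENNReal.toReal_nonneg
  have h7 : 0 ≤ countIn p x / Fintype.card ι := by positivity
  have h8 : 0 ≤ vol (K ∩ Set.Iic x) / vol K := div_nonneg h3 ENNReal.toReal_nonneg
  rw [discrep, abs_le]
  constructor <;> linarith

/-- The mean squared discrepancy as the integral over `K` of pointwise variance plus squared bias
of the counting function. -/
lemma meanL2sq_eq [Nonempty ι] {Ω : ι → Set (Fin d → ℝ)} (hΩ : ∀ i, IsCell (Ω i))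
    {K : Set (Fin d → ℝ)} (hK : MeasurableSet K) (hK' : volume K ≠ ⊤) :
    IntegrableOn (fun x => (∑ i, (qfun Ω i x - qfun Ω i x ^ 2)) / (Fintype.card ι : ℝ) ^ 2 +
        ((∑ i, qfun Ω i x) / (Fintype.card ι : ℝ) - vol (K ∩ Set.Iic x) / vol K) ^ 2) K ∧
    meanL2sq K Ω = (1 / vol K) * ∫ x in K,
      ((∑ i, (qfun Ω i x - qfun Ω i x ^ 2)) / (Fintype.card ι : ℝ) ^ 2 +
        ((∑ i, qfun Ω i x) / (Fintype.card ι : ℝ) - vol (K ∩ Set.Iic x) / vol K) ^ 2) := by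
  have := fun i => (hΩ i).isProbabilityMeasure
  have hprob : IsProbabilityMeasure (stratDist Ω) := by unfold stratDist; infer_instance
  have : IsFiniteMeasure (volume.restrict K) := isFiniteMeasure_restrict.2 hK'
  have hint : Integrable (Function.uncurry fun (p : ι → (Fin d → ℝ)) x => (discrep K p x) ^ 2)
      ((stratDist Ω).prod (volume.restrict K)) := by
    refine Integrable.of_bound (C := 1)
      ((measurable_discrep hK hK').pow_const 2).aestronglyMeasurable (ae_of_all _ fun q => ?_)
    have := abs_discrep_le_one K hK' q.1 q.2
    simp only [Function.uncurry, norm_pow, Real.norm_eq_abs]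
    exact pow_le_one₀ (abs_nonneg _) this
  simp_rw [← integral_sq_discrep hΩ K]
  refine ⟨hint.integral_prod_right, ?_⟩
  rw [meanL2sq, integral_const_mul, integral_integral_swap hint]

/-- Splits the first two coordinates off a vector. -/
def splitTwo (n : ℕ) : (Fin (n + 2) → ℝ) ≃ᵐ (ℝ × ℝ) × (Fin n → ℝ) :=
  ((MeasurableEquiv.piFinSuccAbove (fun _ => ℝ) 0).trans
    ((MeasurableEquiv.refl ℝ).prodCongr (MeasurableEquiv.piFinSuccAbove (fun _ => ℝ) 0))).trans
    MeasurableEquiv.prodAssoc.symm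

lemma splitTwo_apply {n : ℕ} (x : Fin (n + 2) → ℝ) :
    splitTwo n x = ((x 0, x 1), fun k => x k.succ.succ) := rfl

lemma volume_preserving_splitTwo (n : ℕ) : MeasurePreserving (splitTwo n) :=
  (((MeasurePreserving.id volume).prod
      (volume_preserving_piFinSuccAbove (fun _ : Fin (n + 1) => ℝ) 0)).comp
    (volume_preserving_piFinSuccAbove (fun _ : Fin (n + 2) => ℝ) 0)).trans
    (volume_preserving_prodAssoc (α₁ := ℝ) (β₁ := ℝ) (γ₁ := Fin n → ℝ)).symm

/-- The unit prism over a planar set. -/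
def prism (n : ℕ) (T : Set (ℝ × ℝ)) : Set (Fin (n + 2) → ℝ) :=
  splitTwo n ⁻¹' (T ×ˢ Set.Icc 0 1)

lemma mem_prism {n : ℕ} {T : Set (ℝ × ℝ)} {x : Fin (n + 2) → ℝ} :
    x ∈ prism n T ↔ (x 0, x 1) ∈ T ∧ ∀ k : Fin n, 0 ≤ x k.succ.succ ∧ x k.succ.succ ≤ 1 := by
  simp [prism, splitTwo_apply, Pi.le_def, forall_and]

lemma measurableSet_prism {n : ℕ} {T : Set (ℝ × ℝ)} (hT : MeasurableSet T) :
    MeasurableSet (prism n T) :=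
  (splitTwo n).measurable (hT.prod measurableSet_Icc)

/-- The box `[0,2] × [0,1]^{n+1}`. -/
def refBox (n : ℕ) : Set (Fin (n + 2) → ℝ) := prism n (Set.Icc 0 2 ×ˢ Set.Icc 0 1)

lemma mem_refBox {n : ℕ} {x : Fin (n + 2) → ℝ} :
    x ∈ refBox n ↔ ((0 ≤ x 0 ∧ x 0 ≤ 2) ∧ (0 ≤ x 1 ∧ x 1 ≤ 1)) ∧
      ∀ k : Fin n, 0 ≤ x k.succ.succ ∧ x k.succ.succ ≤ 1 := by
  simp only [refBox, mem_prism, Set.mem_prod, Set.mem_Icc]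

lemma vol_prism_inter_Iic {n : ℕ} (T : Set (ℝ × ℝ)) {y : Fin (n + 2) → ℝ} (hy : y ∈ refBox n) :
    vol (prism n T ∩ Set.Iic y) =
      volume.real (T ∩ Set.Iic (y 0, y 1)) * ∏ k : Fin n, y k.succ.succ := by
  have hset : prism n T ∩ Set.Iic y =
      splitTwo n ⁻¹' ((T ∩ Set.Iic (y 0, y 1)) ×ˢ Set.Icc 0 (fun k => y k.succ.succ)) := by
    ext x
    rw [mem_refBox] at hy
    simp only [Set.mem_inter_iff, mem_prism, Set.mem_preimage, splitTwo_apply, Set.mem_prod,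
      Set.mem_Iic, Set.mem_Icc, Pi.le_def, Fin.forall_fin_succ, Prod.mk_le_mk, Pi.zero_apply]
    constructor
    · rintro ⟨⟨h1, h2⟩, h3, h4, h5⟩
      exact ⟨⟨h1, h3, h4⟩, fun k => (h2 k).1, h5⟩
    · rintro ⟨⟨h1, h3, h4⟩, h2, h5⟩
      exact ⟨⟨h1, fun k => ⟨h2 k, (h5 k).trans (hy.2 k).2⟩⟩, h3, h4, h5⟩
  rw [vol, hset, (volume_preserving_splitTwo n).measure_preimage_equiv, Measure.volume_eq_prod,
    Measure.prod_prod, ENNReal.toReal_mul, Real.volume_Icc_pi_toReal, measureReal_def]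
  · simp
  · exact fun k => ((mem_refBox.1 hy).2 k).1

lemma vol_prism_inter_Iic_of_notMem {n : ℕ} {T : Set (ℝ × ℝ)} (hT : T ⊆ Set.Icc 0 2 ×ˢ Set.Icc 0 1)
    {y : Fin (n + 2) → ℝ} (hy : y ∉ refBox n) (hy0 : y 0 ≤ 2) (hy1 : ∀ k : Fin (n + 1), y k.succ ≤ 1) :
    vol (prism n T ∩ Set.Iic y) = 0 := by
  have hset : prism n T ∩ Set.Iic y = ∅ := by
    rw [Set.eq_empty_iff_forall_notMem]
    rintro x ⟨hx, hxy⟩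
    rw [mem_prism] at hx
    have h := hT hx.1
    simp only [Set.mem_prod, Set.mem_Icc] at h
    exact hy (mem_refBox.2 ⟨⟨⟨h.1.1.trans (hxy 0), hy0⟩, h.2.1.trans (hxy 1), hy1 0⟩,
      fun k => ⟨(hx.2 k).1.trans (hxy _), hy1 k.succ⟩⟩)
  simp [vol, hset]

lemma vol_prism {n : ℕ} {T : Set (ℝ × ℝ)} (hT : T ⊆ Set.Icc 0 2 ×ˢ Set.Icc 0 1) :
    vol (prism n T) = volume.real T := by
  have hy : (Fin.cons 2 1 : Fin (n + 2) → ℝ) ∈ refBox n := by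
    rw [mem_refBox]
    refine ⟨⟨by simp, ?_⟩, fun k => ?_⟩
    · change (0 : ℝ) ≤ 1 ∧ (1 : ℝ) ≤ 1
      simp
    · simp
  have h := vol_prism_inter_Iic T hy
  have h1 : prism n T ∩ Set.Iic (Fin.cons 2 1) = prism n T := by
    rw [Set.inter_eq_left]
    intro x hx
    rw [mem_prism] at hx
    have h := hT hx.1
    simp only [Set.mem_prod, Set.mem_Icc] at h
    rw [Set.mem_Iic, Pi.le_def, Fin.forall_fin_succ, Fin.forall_fin_succ]
    exact ⟨h.1.2, h.2.2, fun k => (hx.2 k).2⟩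
  have h2 : T ∩ Set.Iic ((2 : ℝ), (1 : ℝ)) = T := by
    rw [Set.inter_eq_left]
    intro p hp
    have h := hT hp
    exact ⟨h.1.2, h.2.2⟩
  rw [h1] at h
  rw [h]
  have : ((Fin.cons 2 1 : Fin (n + 2) → ℝ) 1) = 1 := rfl
  simp [this, h2]

/-- The lower-left half of the rectangle `[0,2] × [0,1]`. -/
def triA : Set (ℝ × ℝ) := {p | 0 ≤ p.1 ∧ 0 ≤ p.2 ∧ p.1 / 2 + p.2 ≤ 1}

/-- The upper-right half of the rectangle `[0,2] × [0,1]`. -/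
def triB : Set (ℝ × ℝ) := {p | p.1 ≤ 2 ∧ p.2 ≤ 1 ∧ 1 ≤ p.1 / 2 + p.2}

lemma measurableSet_triA : MeasurableSet triA := by
  unfold triA
  measurability

lemma measurableSet_triB : MeasurableSet triB := by
  unfold triB
  measurability

lemma triA_subset : triA ⊆ Set.Icc 0 2 ×ˢ Set.Icc 0 1 := by
  rintro p ⟨h1, h2, h3⟩
  exact ⟨⟨h1, by linarith⟩, h2, by linarith⟩

lemma triB_subset : triB ⊆ Set.Icc 0 2 ×ˢ Set.Icc 0 1 := by
  rintro p ⟨h1, h2, h3⟩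
  exact ⟨⟨by linarith, h1⟩, by linarith, h2⟩

lemma volume_triB_inter_Iic {u v : ℝ} (hu2 : u ≤ 2) (hv1 : v ≤ 1) :
    volume.real (triB ∩ Set.Iic (u, v)) = (max 0 (u / 2 + v - 1)) ^ 2 := by
  have hslice : ∀ a, volume (Prod.mk a ⁻¹' (triB ∩ Set.Iic (u, v))) =
      (Set.Icc (2 - 2 * v) u).indicator (fun a => ENNReal.ofReal (v - 1 + a / 2)) a := by
    intro a
    have : Prod.mk a ⁻¹' (triB ∩ Set.Iic (u, v)) =
        {b | a ≤ u ∧ b ∈ Set.Icc (1 - a / 2) v} := by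
      ext b
      simp only [triB, Set.mem_preimage, Set.mem_inter_iff, Set.mem_ofPred_eq, Set.mem_Iic,
        Prod.mk_le_mk, Set.mem_Icc]
      constructor
      · rintro ⟨⟨h1, h2, h3⟩, h4, h5⟩
        exact ⟨h4, by linarith, h5⟩
      · rintro ⟨h1, h2, h3⟩
        exact ⟨⟨by linarith, by linarith, by linarith⟩, h1, h3⟩
    rw [this]
    by_cases ha : a ≤ u
    · simp only [ha, true_and, Set.ofPred_mem_eq, Real.volume_Icc]
      by_cases ha' : 2 - 2 * v ≤ a
      · rw [Set.indicator_of_mem (show a ∈ Set.Icc (2 - 2 * v) u from ⟨ha', ha⟩)]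
        congr 1; ring
      · rw [Set.indicator_of_notMem fun h => ha' h.1, ENNReal.ofReal_of_nonpos (by linarith)]
    · rw [Set.indicator_of_notMem fun h => ha h.2]
      simp [ha]
  rw [measureReal_def, Measure.volume_eq_prod,
    Measure.prod_apply (measurableSet_triB.inter measurableSet_Iic)]
  simp_rw [hslice]
  rw [lintegral_indicator measurableSet_Icc]
  rcases le_total (2 - 2 * v) u with h | h
  · rw [← ofReal_integral_eq_lintegral_ofReal, ENNReal.toReal_ofReal, integral_Icc_eq_integral_Ioc,
      ← intervalIntegral.integral_of_le h, max_eq_right (by linarith)]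
    · rw [intervalIntegral.integral_add (by simp) (by simp)]
      simp
      ring
    · exact setIntegral_nonneg measurableSet_Icc fun a ha => by linarith [ha.1]
    · exact Continuous.integrableOn_Icc (by fun_prop)
    · exact (ae_restrict_mem measurableSet_Icc).mono fun a ha => by
        simp only [Pi.zero_apply]; linarith [ha.1]
  · rw [max_eq_left (by linarith), setLIntegral_measure_zero]
    · simp
    · simp; linarith

lemma volume_triA_inter_Iic {u v : ℝ} (hu : 0 ≤ u) (hu2 : u ≤ 2) (hv : 0 ≤ v) (hv1 : v ≤ 1) :
    volume.real (triA ∩ Set.Iic (u, v)) = u * v - (max 0 (u / 2 + v - 1)) ^ 2 := by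
  have hline : volume {p : ℝ × ℝ | p.2 = 1 - p.1 / 2} = 0 := by
    rw [Measure.volume_eq_prod, Measure.measure_prod_null]
    · refine ae_of_all _ fun a => ?_
      have : Prod.mk a ⁻¹' {p : ℝ × ℝ | p.2 = 1 - p.1 / 2} = {1 - a / 2} := by ext; simp
      simp [this]
    · exact measurableSet_eq_fun measurable_snd (by fun_prop)
  have hsub : triB ∩ Set.Iic (u, v) ⊆ Set.Icc 0 u ×ˢ Set.Icc 0 v := by
    rintro p ⟨hp, hp'⟩
    have h := triB_subset hp
    exact ⟨⟨h.1.1, hp'.1⟩, h.2.1, hp'.2⟩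
  have hae : (triA ∩ Set.Iic (u, v) : Set (ℝ × ℝ)) =ᵐ[volume]
      ((Set.Icc 0 u ×ˢ Set.Icc 0 v) \ (triB ∩ Set.Iic (u, v)) : Set (ℝ × ℝ)) := by
    filter_upwards [compl_mem_ae_iff.2 hline] with p hp
    have hp' : p.2 ≠ 1 - p.1 / 2 := hp
    apply propext
    change (p ∈ triA ∩ Set.Iic (u, v)) ↔
      p ∈ (Set.Icc 0 u ×ˢ Set.Icc 0 v) \ (triB ∩ Set.Iic (u, v))
    simp only [triA, triB, Set.mem_inter_iff, Set.mem_ofPred_eq, Set.mem_Iic, Set.mem_sdiff,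
      Set.mem_prod, Set.mem_Icc, Prod.le_def]
    constructor
    · rintro ⟨⟨h1, h2, h3⟩, h4, h5⟩
      refine ⟨⟨⟨h1, h4⟩, h2, h5⟩, fun h => hp' ?_⟩
      linarith [h.1.2.2]
    · rintro ⟨⟨⟨h1, h4⟩, h2, h5⟩, h⟩
      refine ⟨⟨h1, h2, ?_⟩, h4, h5⟩
      by_contra! hc
      exact h ⟨⟨h4.trans hu2, h5.trans hv1, hc.le⟩, h4, h5⟩
  rw [measureReal_congr hae, measureReal_sdiff hsub (measurableSet_triB.inter measurableSet_Iic)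
      (isCompact_Icc.prod isCompact_Icc).measure_ne_top,
    volume_triB_inter_Iic hu2 hv1, Measure.volume_eq_prod, measureReal_prod_prod,
    Real.volume_real_Icc_of_le hu, Real.volume_real_Icc_of_le hv]
  simp

lemma volume_rect_inter_Iic {a b u v : ℝ} (hv : 0 ≤ v) (hv1 : v ≤ 1) :
    volume.real ((Set.Icc a b ×ˢ Set.Icc (0 : ℝ) 1) ∩ Set.Iic (u, v)) =
      max (min b u - a) 0 * v := by
  have : (Set.Icc a b ×ˢ Set.Icc (0 : ℝ) 1) ∩ Set.Iic (u, v) =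
      Set.Icc a (min b u) ×ˢ Set.Icc 0 v := by
    ext p
    simp only [Set.mem_inter_iff, Set.mem_Iic, Set.mem_prod, Set.mem_Icc, Prod.le_def, le_min_iff]
    constructor
    · rintro ⟨⟨⟨h1, h2⟩, h3, h4⟩, h5, h6⟩
      exact ⟨⟨h1, h2, h5⟩, h3, h6⟩
    · rintro ⟨⟨h1, h2, h5⟩, h3, h6⟩
      exact ⟨⟨⟨h1, h2⟩, h3, h6.trans hv1⟩, h5, h6⟩
  rw [this, Measure.volume_eq_prod, measureReal_prod_prod, Real.volume_real_Icc,
    Real.volume_real_Icc_of_le hv, sub_zero]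

lemma integral_prod_sq (n : ℕ) :
    ∫ w in Set.Icc (0 : Fin n → ℝ) 1, (∏ k, w k) ^ 2 = ((3 : ℝ) ^ n)⁻¹ := by
  rw [← Set.pi_univ_Icc, volume_pi, Measure.restrict_pi_pi]
  simp_rw [← Finset.prod_pow]
  simp only [Pi.zero_apply, Pi.one_apply]
  rw [integral_fintype_prod_eq_pow (fun t : ℝ => t ^ 2), integral_Icc_eq_integral_Ioc,
    ← intervalIntegral.integral_of_le zero_le_one, integral_pow, ← inv_pow]
  norm_num

lemma integral_refBox_mul {n : ℕ} (f : ℝ × ℝ → ℝ) :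
    ∫ y in refBox n, f (y 0, y 1) * (∏ k : Fin n, y k.succ.succ) ^ 2 =
      (∫ p in Set.Icc (0 : ℝ) 2 ×ˢ Set.Icc (0 : ℝ) 1, f p) * ((3 : ℝ) ^ n)⁻¹ := by
  rw [← integral_prod_sq n, ← setIntegral_prod_mul, refBox, prism]
  exact (volume_preserving_splitTwo n).setIntegral_preimage_emb
    (splitTwo n).measurableEmbedding (fun z => f z.1 * (∏ k, z.2 k) ^ 2) _

lemma setIntegral_rect {f : ℝ × ℝ → ℝ} (hf : Continuous f) :
    ∫ p in Set.Icc (0 : ℝ) 2 ×ˢ Set.Icc (0 : ℝ) 1, f p =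
      ∫ u in (0 : ℝ)..2, ∫ v in (0 : ℝ)..1, f (u, v) := by
  rw [Measure.volume_eq_prod, setIntegral_prod]
  · simp_rw [integral_Icc_eq_integral_Ioc, ← intervalIntegral.integral_of_le zero_le_one]
    rw [← intervalIntegral.integral_of_le zero_le_two]
  · rw [← Measure.volume_eq_prod]
    exact hf.continuousOn.integrableOn_compact (isCompact_Icc.prod isCompact_Icc)

lemma integral_sq_triangles {u : ℝ} (hu : 0 ≤ u) (hu2 : u ≤ 2) :
    ∫ v in (0 : ℝ)..1, ((u * v - (max 0 (u / 2 + v - 1)) ^ 2) ^ 2 +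
      ((max 0 (u / 2 + v - 1)) ^ 2) ^ 2) =
    u ^ 2 / 3 - 2 * u * (u ^ 3 / 24 - u ^ 4 / 192) + u ^ 5 / 80 := by
  have h1 : ∫ v in (0 : ℝ)..(1 - u / 2), ((u * v - (max 0 (u / 2 + v - 1)) ^ 2) ^ 2 +
      ((max 0 (u / 2 + v - 1)) ^ 2) ^ 2) = ∫ v in (0 : ℝ)..(1 - u / 2), u ^ 2 * v ^ 2 := by
    refine intervalIntegral.integral_congr fun v hv => ?_
    rw [Set.uIcc_of_le (by linarith)] at hv
    simp only [max_eq_left (show u / 2 + v - 1 ≤ 0 by linarith [hv.2])]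
    ring
  have h2 : ∫ v in (1 - u / 2)..1, ((u * v - (max 0 (u / 2 + v - 1)) ^ 2) ^ 2 +
      ((max 0 (u / 2 + v - 1)) ^ 2) ^ 2) =
      ∫ v in (1 - u / 2)..1, ((u * v - (u / 2 + v - 1) ^ 2) ^ 2 + (u / 2 + v - 1) ^ 4) := by
    refine intervalIntegral.integral_congr fun v hv => ?_
    rw [Set.uIcc_of_le (by linarith)] at hv
    simp only [max_eq_right (show 0 ≤ u / 2 + v - 1 by linarith [hv.1])]
    ring
  have h3 : ∫ v in (1 - u / 2)..1, ((u * v - (u / 2 + v - 1) ^ 2) ^ 2 + (u / 2 + v - 1) ^ 4) =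
      ∫ t in (0 : ℝ)..(u / 2), ((u * (t + (1 - u / 2)) - t ^ 2) ^ 2 + t ^ 4) := by
    have := intervalIntegral.integral_comp_sub_right (a := 1 - u / 2) (b := 1)
      (fun t => (u * (t + (1 - u / 2)) - t ^ 2) ^ 2 + t ^ 4) (1 - u / 2)
    rw [show (1 - u / 2) - (1 - u / 2) = 0 by ring, show 1 - (1 - u / 2) = u / 2 by ring] at this
    rw [← this]
    refine intervalIntegral.integral_congr fun v _ => ?_
    ring
  have h4 : ∫ t in (0 : ℝ)..(u / 2), ((u * (t + (1 - u / 2)) - t ^ 2) ^ 2 + t ^ 4) =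
      ∫ t in (0 : ℝ)..(u / 2), (u ^ 2 * (1 - u / 2) ^ 2 + 2 * u ^ 2 * (1 - u / 2) * t ^ 1
        + (u ^ 2 - 2 * u * (1 - u / 2)) * t ^ 2 + (- 2 * u) * t ^ 3 + 2 * t ^ 4) := by
    refine intervalIntegral.integral_congr fun t _ => ?_
    ring
  have hI : ∀ a b : ℝ, IntervalIntegrable (fun v => (u * v - (max 0 (u / 2 + v - 1)) ^ 2) ^ 2 +
      ((max 0 (u / 2 + v - 1)) ^ 2) ^ 2) volume a b := fun a b =>
    Continuous.intervalIntegrable (by fun_prop) a b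
  rw [← intervalIntegral.integral_add_adjacent_intervals (hI 0 (1 - u / 2)) (hI _ 1), h1, h2, h3,
    h4]
  repeat rw [intervalIntegral.integral_add (Continuous.intervalIntegrable (by fun_prop) _ _)
    (Continuous.intervalIntegrable (by fun_prop) _ _)]
  simp only [intervalIntegral.integral_const_mul, integral_pow, intervalIntegral.integral_const,
    smul_eq_mul]
  push_cast
  ring

/-- Planar integral of the squared area functions of the two triangles. -/
lemma integral_rect_triangles :
    ∫ p in Set.Icc (0 : ℝ) 2 ×ˢ Set.Icc (0 : ℝ) 1,
      ((p.1 * p.2 - (max 0 (p.1 / 2 + p.2 - 1)) ^ 2) ^ 2 +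
        ((max 0 (p.1 / 2 + p.2 - 1)) ^ 2) ^ 2) = 3 / 5 := by
  rw [setIntegral_rect (by fun_prop)]
  have : ∫ u in (0 : ℝ)..2, ∫ v in (0 : ℝ)..1, ((u * v - (max 0 (u / 2 + v - 1)) ^ 2) ^ 2 +
      ((max 0 (u / 2 + v - 1)) ^ 2) ^ 2) =
      ∫ u in (0 : ℝ)..2, (1 / 3 * u ^ 2 + (- 1 / 12) * u ^ 4 + 11 / 480 * u ^ 5) := by
    refine intervalIntegral.integral_congr fun u hu => ?_
    rw [Set.uIcc_of_le zero_le_two] at hu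
    simp only [integral_sq_triangles hu.1 hu.2]
    ring
  rw [this]
  repeat rw [intervalIntegral.integral_add (Continuous.intervalIntegrable (by fun_prop) _ _)
    (Continuous.intervalIntegrable (by fun_prop) _ _)]
  simp only [intervalIntegral.integral_const_mul, integral_pow]
  norm_num

/-- Planar integral of the squared area functions of the two unit squares. -/
lemma integral_rect_squares :
    ∫ p in Set.Icc (0 : ℝ) 2 ×ˢ Set.Icc (0 : ℝ) 1,
      ((min 1 p.1 * p.2) ^ 2 + (max (p.1 - 1) 0 * p.2) ^ 2) = 5 / 9 := by
  rw [setIntegral_rect (by fun_prop)]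
  have : ∀ u : ℝ, ∫ v in (0 : ℝ)..1, ((min 1 u * v) ^ 2 + (max (u - 1) 0 * v) ^ 2) =
      ((min 1 u) ^ 2 + (max (u - 1) 0) ^ 2) / 3 := by
    intro u
    simp_rw [mul_pow, ← add_mul]
    rw [intervalIntegral.integral_const_mul, integral_pow]
    norm_num
    ring
  simp_rw [this]
  have hI : ∀ a b : ℝ, IntervalIntegrable (fun u : ℝ => ((min 1 u) ^ 2 + (max (u - 1) 0) ^ 2) / 3)
      volume a b := fun a b => Continuous.intervalIntegrable (by fun_prop) a b
  have h1 : ∫ u in (0 : ℝ)..1, ((min 1 u) ^ 2 + (max (u - 1) 0) ^ 2) / 3 =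
      ∫ u in (0 : ℝ)..1, 1 / 3 * u ^ 2 := by
    refine intervalIntegral.integral_congr fun u hu => ?_
    rw [Set.uIcc_of_le zero_le_one] at hu
    simp only [min_eq_right hu.2, max_eq_right (sub_nonpos.2 hu.2)]
    ring
  have h2 : ∫ u in (1 : ℝ)..2, ((min 1 u) ^ 2 + (max (u - 1) 0) ^ 2) / 3 =
      ∫ u in (1 : ℝ)..2, (2 / 3 + (- 2 / 3) * u ^ 1 + 1 / 3 * u ^ 2) := by
    refine intervalIntegral.integral_congr fun u hu => ?_
    rw [Set.uIcc_of_le one_le_two] at hu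
    simp only [min_eq_left hu.1, max_eq_left (sub_nonneg.2 hu.1)]
    ring
  rw [← intervalIntegral.integral_add_adjacent_intervals (hI 0 1) (hI 1 2), h1, h2]
  repeat rw [intervalIntegral.integral_add (Continuous.intervalIntegrable (by fun_prop) _ _)
    (Continuous.intervalIntegrable (by fun_prop) _ _)]
  simp only [intervalIntegral.integral_const_mul, integral_pow, intervalIntegral.integral_const,
    smul_eq_mul]
  norm_num

lemma mem_convexHull_triple {E : Type*} [AddCommGroup E] [Module ℝ E] {p q r z : E} :
    z ∈ convexHull ℝ {p, q, r} ↔ ∃ a b c : ℝ, 0 ≤ a ∧ 0 ≤ b ∧ 0 ≤ c ∧ a + b + c = 1 ∧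
      a • p + b • q + c • r = z := by
  constructor
  · rw [convexHull_insert (Set.insert_nonempty _ _), convexHull_pair]
    simp only [mem_convexJoin, Set.mem_singleton_iff, exists_eq_left]
    rintro ⟨w, ⟨s, t, hs, ht, hst, rfl⟩, a, b, ha, hb, hab, rfl⟩
    refine ⟨a, b * s, b * t, ha, mul_nonneg hb hs, mul_nonneg hb ht, ?_, ?_⟩
    · rw [add_assoc, ← mul_add, hst, mul_one, hab]
    · rw [smul_add, smul_smul, smul_smul, add_assoc]
  · rintro ⟨a, b, c, ha, hb, hc, habc, rfl⟩
    have h := (convex_convexHull ℝ {p, q, r}).sum_mem (t := Finset.univ)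
      (w := ![a, b, c]) (z := ![p, q, r])
      (by simp [Fin.forall_fin_succ, ha, hb, hc])
      (by simp [Fin.sum_univ_three, habc])
      (by
        simp only [Finset.mem_univ, true_imp_iff, Fin.forall_fin_succ]
        refine ⟨subset_convexHull ℝ _ ?_, subset_convexHull ℝ _ ?_, subset_convexHull ℝ _ ?_, ?_⟩
        all_goals simp)
    simpa [Fin.sum_univ_three] using h

/-- The affine bijection mapping `[1-2/M,1] × [1-1/M,1]^{n+1}` onto `[0,2] × [0,1]^{n+1}`. -/
def refMap (n : ℕ) (M : ℝ) (x : Fin (n + 2) → ℝ) : Fin (n + 2) → ℝ :=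
  M • x - Fin.cons (M - 2) (fun _ => M - 1)

lemma refMap_zero (n : ℕ) (M : ℝ) (x : Fin (n + 2) → ℝ) :
    refMap n M x 0 = M * x 0 - (M - 2) := by simp [refMap]

lemma refMap_succ (n : ℕ) (M : ℝ) (x : Fin (n + 2) → ℝ) (k : Fin (n + 1)) :
    refMap n M x k.succ = M * x k.succ - (M - 1) := by simp [refMap]

lemma refMap_one (n : ℕ) (M : ℝ) (x : Fin (n + 2) → ℝ) :
    refMap n M x 1 = M * x 1 - (M - 1) := refMap_succ n M x 0

lemma measurable_refMap (n : ℕ) (M : ℝ) : Measurable (refMap n M) := by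
  unfold refMap
  fun_prop

lemma refMap_le_refMap {n : ℕ} {M : ℝ} (hM : 0 < M) {x y : Fin (n + 2) → ℝ} :
    refMap n M x ≤ refMap n M y ↔ x ≤ y := by
  simp only [refMap, sub_le_sub_iff_right, Pi.le_def, Pi.smul_apply, smul_eq_mul]
  exact forall_congr' fun k => mul_le_mul_iff_of_pos_left hM

lemma vol_preimage_refMap {n : ℕ} {M : ℝ} (hM : 0 < M) (S : Set (Fin (n + 2) → ℝ)) :
    vol (refMap n M ⁻¹' S) = (M ^ (n + 2))⁻¹ * vol S := by
  have h : refMap n M ⁻¹' S = (M • ·) ⁻¹'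
      ((fun x => x + -(Fin.cons (M - 2) (fun _ => M - 1) : Fin (n + 2) → ℝ)) ⁻¹' S) := by
    simp only [← sub_eq_add_neg]
    rfl
  rw [vol, h, Measure.addHaar_preimage_smul _ hM.ne', measure_preimage_add_right,
    ENNReal.toReal_mul, ENNReal.toReal_ofReal (abs_nonneg _), abs_of_pos (by positivity), vol]
  simp

lemma integral_comp_refMap {n : ℕ} {M : ℝ} (hM : 0 < M) (G : (Fin (n + 2) → ℝ) → ℝ) :
    ∫ x, G (refMap n M x) = (M ^ (n + 2))⁻¹ * ∫ y, G y := by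
  have h := Measure.integral_comp_smul volume
    (fun x => G (x - (Fin.cons (M - 2) (fun _ => M - 1) : Fin (n + 2) → ℝ))) M
  rw [integral_sub_right_eq_self, abs_of_pos (by positivity)] at h
  simpa [refMap] using h

/-- A planar set of unit area inside `[0,2] × [0,1]`. -/
structure IsUnitTile (T : Set (ℝ × ℝ)) : Prop where
  measurableSet : MeasurableSet T
  subset : T ⊆ Set.Icc 0 2 ×ˢ Set.Icc 0 1
  area : volume.real T = 1

lemma inter_Iic_two_one {T : Set (ℝ × ℝ)} (hT : T ⊆ Set.Icc 0 2 ×ˢ Set.Icc 0 1) :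
    T ∩ Set.Iic ((2 : ℝ), (1 : ℝ)) = T :=
  Set.inter_eq_left.2 fun _ hp => ⟨(hT hp).1.2, (hT hp).2.2⟩

lemma isUnitTile_triA : IsUnitTile triA := by
  refine ⟨measurableSet_triA, triA_subset, ?_⟩
  rw [← inter_Iic_two_one triA_subset, volume_triA_inter_Iic] <;> norm_num

lemma isUnitTile_triB : IsUnitTile triB := by
  refine ⟨measurableSet_triB, triB_subset, ?_⟩
  rw [← inter_Iic_two_one triB_subset, volume_triB_inter_Iic] <;> norm_num

lemma isUnitTile_rect {a b : ℝ} (ha : 0 ≤ a) (hb : b ≤ 2) (hab : b - a = 1) :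
    IsUnitTile (Set.Icc a b ×ˢ Set.Icc 0 1) := by
  refine ⟨measurableSet_Icc.prod measurableSet_Icc,
    Set.prod_mono (Set.Icc_subset_Icc ha hb) subset_rfl, ?_⟩
  rw [Measure.volume_eq_prod, measureReal_prod_prod, Real.volume_real_Icc, Real.volume_real_Icc,
    hab]
  norm_num

/-- The cell of the `M`-scaled partition corresponding to a planar tile. -/
def tileCell (n : ℕ) (M : ℝ) (T : Set (ℝ × ℝ)) : Set (Fin (n + 2) → ℝ) :=
  refMap n M ⁻¹' prism n T

lemma IsUnitTile.vol_tileCell {n : ℕ} {M : ℝ} (hM : 0 < M) {T : Set (ℝ × ℝ)}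
    (hT : IsUnitTile T) : vol (tileCell n M T) = (M ^ (n + 2))⁻¹ := by
  rw [tileCell, vol_preimage_refMap hM, vol_prism hT.subset, hT.area, mul_one]

lemma IsUnitTile.isCell {n : ℕ} {M : ℝ} (hM : 0 < M) {T : Set (ℝ × ℝ)}
    (hT : IsUnitTile T) : IsCell (tileCell n M T) := by
  have h : (volume (tileCell n M T)).toReal ≠ 0 := by
    change vol (tileCell n M T) ≠ 0
    rw [hT.vol_tileCell hM]
    positivity
  exact ⟨measurable_refMap n M (measurableSet_prism hT.measurableSet),
    fun h0 => h (by simp [h0]), fun h0 => h (by simp [h0])⟩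

lemma IsUnitTile.qfun_eq {n : ℕ} {M : ℝ} (hM : 0 < M) {T : Set (ℝ × ℝ)} (hT : IsUnitTile T)
    {κ : Type} {Ω : κ → Set (Fin (n + 2) → ℝ)} {i : κ} (hi : Ω i = tileCell n M T) (x : Fin (n + 2) → ℝ) :
    qfun Ω i x = vol (prism n T ∩ Set.Iic (refMap n M x)) := by
  have h : tileCell n M T ∩ Set.Iic x = refMap n M ⁻¹' (prism n T ∩ Set.Iic (refMap n M x)) := by
    ext z
    simp [tileCell, refMap_le_refMap hM]
  rw [qfun, hi, hT.vol_tileCell hM, h, vol_preimage_refMap hM]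
  field_simp

lemma jitteredCube_idxA {n m : ℕ} (hm : 2 ≤ m) :
    jitteredCube m (idxA (n + 2) m hm) = tileCell n m (Set.Icc 0 1 ×ˢ Set.Icc 0 1) := by
  have hm0 : (0 : ℝ) < m := by positivity
  ext x
  simp only [jitteredCube, tileCell, Set.mem_preimage, mem_prism, refMap_zero, refMap_one,
    refMap_succ, Set.mem_Icc, Pi.le_def, Fin.forall_fin_succ, idxA, Set.mem_prod,
    div_le_iff₀ hm0, le_div_iff₀ hm0, Fin.val_zero, Fin.val_succ, if_true, Nat.succ_ne_zero,
    if_false, Nat.cast_sub hm, Nat.cast_sub (one_le_two.trans hm), Nat.cast_ofNat, Nat.cast_one,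
    Fin.succ_zero_eq_one]
  constructor
  · rintro ⟨⟨h1, h2, h3⟩, h4, h5, h6⟩
    exact ⟨⟨⟨by linarith, by linarith⟩, by linarith, by linarith⟩,
      fun k => ⟨by linarith [h3 k], by linarith [h6 k]⟩⟩
  · rintro ⟨⟨⟨h1, h2⟩, h3, h4⟩, h5⟩
    exact ⟨⟨by linarith, by linarith, fun k => by linarith [h5 k]⟩, by linarith, by linarith,
      fun k => by linarith [h5 k]⟩

lemma jitteredCube_idxB {n m : ℕ} (hm : 2 ≤ m) :
    jitteredCube m (idxB (n + 2) m hm) = tileCell n m (Set.Icc 1 2 ×ˢ Set.Icc 0 1) := by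
  have hm0 : (0 : ℝ) < m := by positivity
  ext x
  simp only [jitteredCube, tileCell, Set.mem_preimage, mem_prism, refMap_zero, refMap_one,
    refMap_succ, Set.mem_Icc, Pi.le_def, Fin.forall_fin_succ, idxB, Set.mem_prod,
    div_le_iff₀ hm0, le_div_iff₀ hm0, Nat.cast_sub (one_le_two.trans hm), Nat.cast_one,
    Fin.succ_zero_eq_one]
  constructor
  · rintro ⟨⟨h1, h2, h3⟩, h4, h5, h6⟩
    exact ⟨⟨⟨by linarith, by linarith⟩, by linarith, by linarith⟩,
      fun k => ⟨by linarith [h3 k], by linarith [h6 k]⟩⟩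
  · rintro ⟨⟨⟨h1, h2⟩, h3, h4⟩, h5⟩
    exact ⟨⟨by linarith, by linarith, fun k => by linarith [h5 k]⟩, by linarith, by linarith,
      fun k => by linarith [h5 k]⟩

lemma unit_bounds_iff {M t : ℝ} (hM : 0 < M) :
    (1 - 1 / M ≤ t ∧ t ≤ 1) ↔ (0 ≤ M * t - (M - 1) ∧ M * t - (M - 1) ≤ 1) := by
  rw [one_sub_div hM.ne', div_le_iff₀ hM]
  refine and_congr ⟨fun h => by linarith, fun h => by linarith⟩
    ⟨fun h => by nlinarith, fun h => ?_⟩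
  by_contra! hc
  nlinarith

lemma forall_two_le_iff {n : ℕ} {p : Fin (n + 2) → Prop} :
    (∀ k : Fin (n + 2), 2 ≤ (k : ℕ) → p k) ↔ ∀ k : Fin n, p k.succ.succ := by
  simp [Fin.forall_fin_succ]

lemma prismA_eq {n m : ℕ} (hm : 2 ≤ m) (hd : 2 ≤ n + 2) :
    prismA (n + 2) m hd = tileCell n m triA := by
  have hm0 : (0 : ℝ) < m := by positivity
  have hm1 : (m : ℝ) ≠ 0 := hm0.ne'
  ext x
  simp only [prismA, tileCell, Set.mem_preimage, mem_prism, refMap_zero, refMap_one,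
    refMap_succ, Set.mem_ofPred_eq, forall_two_le_iff, unit_bounds_iff hm0]
  refine and_congr_left fun _ => ?_
  change ![x 0, x 1] ∈ _ ↔ _
  rw [mem_convexHull_triple]
  constructor
  · rintro ⟨a, b, c, ha, hb, hc, habc, h⟩
    have h0 := congrFun h 0
    have h1 := congrFun h 1
    simp at h0 h1
    rw [← h0, ← h1]
    have ha' : a = 1 - b - c := by linarith
    subst ha'
    have e0 : (m : ℝ) * ((1 - b - c) * (1 - 2 / m) + b + c * (1 - 2 / m)) - (m - 2) = 2 * b := by
      field_simp; ring
    have e1 : (m : ℝ) * ((1 - b - c) * (1 - (m : ℝ)⁻¹) + b * (1 - (m : ℝ)⁻¹) + c) - (m - 1) = c := by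
      field_simp; ring
    rw [e0, e1]
    refine ⟨?_, ?_, ?_⟩ <;> simp only <;> linarith
  · rintro ⟨h1, h2, h3⟩
    simp only at h1 h2 h3
    refine ⟨1 - (m * x 0 - (m - 2)) / 2 - (m * x 1 - (m - 1)), (m * x 0 - (m - 2)) / 2,
      m * x 1 - (m - 1), by linarith, by linarith, by linarith, by ring, ?_⟩
    ext k
    fin_cases k
    · simp; field_simp; ring
    · simp; field_simp; ring

lemma prismB_eq {n m : ℕ} (hm : 2 ≤ m) (hd : 2 ≤ n + 2) :
    prismB (n + 2) m hd = tileCell n m triB := by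
  have hm0 : (0 : ℝ) < m := by positivity
  have hm1 : (m : ℝ) ≠ 0 := hm0.ne'
  ext x
  simp only [prismB, tileCell, Set.mem_preimage, mem_prism, refMap_zero, refMap_one,
    refMap_succ, Set.mem_ofPred_eq, forall_two_le_iff, unit_bounds_iff hm0]
  refine and_congr_left fun _ => ?_
  change ![x 0, x 1] ∈ _ ↔ _
  rw [mem_convexHull_triple]
  constructor
  · rintro ⟨a, b, c, ha, hb, hc, habc, h⟩
    have h0 := congrFun h 0
    have h1 := congrFun h 1
    simp at h0 h1
    rw [← h0, ← h1]
    have ha' : c = 1 - a - b := by linarith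
    subst ha'
    have e0 : (m : ℝ) * (a + b * (1 - 2 / m) + (1 - a - b)) - (m - 2) = 2 - 2 * b := by
      field_simp; ring
    have e1 : (m : ℝ) * (a * (1 - (m : ℝ)⁻¹) + b + (1 - a - b)) - (m - 1) = 1 - a := by
      field_simp; ring
    rw [e0, e1]
    refine ⟨?_, ?_, ?_⟩ <;> simp only <;> linarith
  · rintro ⟨h1, h2, h3⟩
    simp only at h1 h2 h3
    refine ⟨1 - (m * x 1 - (m - 1)), 1 - (m * x 0 - (m - 2)) / 2,
      (m * x 0 - (m - 2)) / 2 + (m * x 1 - (m - 1)) - 1,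
      by linarith, by linarith, by linarith, by ring, ?_⟩
    ext k
    fin_cases k
    · simp; field_simp; ring
    · simp; field_simp; ring

lemma isCell_jitteredCube {d m : ℕ} (hm : 0 < m) (j : Fin d → Fin m) :
    IsCell (jitteredCube m j) := by
  have hm0 : (0 : ℝ) < m := by positivity
  refine ⟨measurableSet_Icc, ?_, isCompact_Icc.measure_ne_top⟩
  rw [jitteredCube, Real.volume_Icc_pi]
  refine Finset.prod_ne_zero_iff.2 fun k _ => ?_
  rw [← sub_div, add_sub_cancel_left]
  simpa using hm.ne'

lemma idxA_ne_idxB {n m : ℕ} (hm : 2 ≤ m) : idxA (n + 2) m hm ≠ idxB (n + 2) m hm := by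
  intro h
  have := congrArg Fin.val (congrFun h 0)
  simp [idxA, idxB] at this
  omega

/-- Replacing two members of a family by two others with the same sum of `q`-functions changes the
mean squared discrepancy only through the sum of the squared `q`-functions. -/
lemma meanL2sq_sub_of_two_changed [Nonempty ι] {Ω Ω' : ι → Set (Fin d → ℝ)}
    (hΩ : ∀ i, IsCell (Ω i)) (hΩ' : ∀ i, IsCell (Ω' i))
    {K : Set (Fin d → ℝ)} (hK : MeasurableSet K) (hK' : volume K ≠ ⊤) {a b : ι} (hab : a ≠ b)
    (hrest : ∀ j, j ≠ a → j ≠ b → Ω' j = Ω j)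
    (hsum : ∀ x ∈ K, qfun Ω a x + qfun Ω b x = qfun Ω' a x + qfun Ω' b x) :
    meanL2sq K Ω - meanL2sq K Ω' = (1 / vol K) * (((Fintype.card ι : ℝ) ^ 2)⁻¹ *
      ∫ x in K, ((qfun Ω' a x ^ 2 + qfun Ω' b x ^ 2) - (qfun Ω a x ^ 2 + qfun Ω b x ^ 2))) := by
  obtain ⟨hi, he⟩ := meanL2sq_eq hΩ hK hK'
  obtain ⟨hi', he'⟩ := meanL2sq_eq hΩ' hK hK'
  rw [he, he', ← mul_sub, ← integral_sub hi hi']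
  congr 1
  rw [← integral_const_mul (μ := volume.restrict K)]
  refine setIntegral_congr_fun hK fun x hx => ?_
  have hrestq : ∀ j, j ≠ a ∧ j ≠ b → qfun Ω' j x = qfun Ω j x := fun j hj => by
    simp only [qfun, hrest j hj.1 hj.2]
  have h1 : ∑ i, (qfun Ω i x - qfun Ω' i x) = 0 := by
    rw [Fintype.sum_eq_add a b hab fun j hj => by rw [hrestq j hj, sub_self]]
    linarith [hsum x hx]
  have h2 : ∑ i, ((qfun Ω i x - qfun Ω i x ^ 2) - (qfun Ω' i x - qfun Ω' i x ^ 2)) =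
      (qfun Ω' a x ^ 2 + qfun Ω' b x ^ 2) - (qfun Ω a x ^ 2 + qfun Ω b x ^ 2) := by
    rw [Fintype.sum_eq_add a b hab fun j hj => by rw [hrestq j hj, sub_self]]
    linarith [hsum x hx]
  rw [Finset.sum_sub_distrib, sub_eq_zero] at h1
  rw [Finset.sum_sub_distrib] at h2
  rw [h1, ← h2]
  ring

lemma refMap_mem_bounds {n m : ℕ} {x : Fin (n + 2) → ℝ}
    (hx : x ∈ Set.Icc (0 : Fin (n + 2) → ℝ) 1) :
    refMap n m x 0 ≤ 2 ∧ ∀ k : Fin (n + 1), refMap n m x k.succ ≤ 1 := by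
  have h : ∀ k, (m : ℝ) * x k ≤ m := fun k =>
    mul_le_of_le_one_right (Nat.cast_nonneg m) (hx.2 k)
  simp only [refMap_zero, refMap_succ]
  exact ⟨by linarith [h 0], fun k => by linarith [h k.succ]⟩

lemma preimage_refBox_subset {n m : ℕ} (hm : 2 ≤ m) :
    refMap n m ⁻¹' refBox n ⊆ Set.Icc (0 : Fin (n + 2) → ℝ) 1 := by
  have hm2 : (2 : ℝ) ≤ m := by exact_mod_cast hm
  have key : ∀ t c e : ℝ, 0 ≤ c → c + e = m → 0 ≤ m * t - c → m * t - c ≤ e → 0 ≤ t ∧ t ≤ 1 :=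
    fun t c e hc hce h0 h1 =>
      ⟨nonneg_of_mul_nonneg_right (show 0 ≤ (m : ℝ) * t by linarith) (by linarith),
        le_of_mul_le_mul_left (show (m : ℝ) * t ≤ m * 1 by linarith) (by linarith)⟩
  intro x hx
  rw [Set.mem_preimage, mem_refBox, refMap_zero, refMap_one] at hx
  simp only [refMap_succ] at hx
  have h0 := key _ _ 2 (by linarith) (by ring) hx.1.1.1 hx.1.1.2
  have h1 := key _ _ 1 (by linarith) (by ring) hx.1.2.1 hx.1.2.2
  have h2 := fun k => key _ _ 1 (by linarith) (by ring) (hx.2 k).1 (hx.2 k).2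
  simp only [Set.mem_Icc, Pi.le_def, Fin.forall_fin_succ]
  exact ⟨⟨h0.1, h1.1, fun k => (h2 k).1⟩, h0.2, h1.2, fun k => (h2 k).2⟩

lemma measurableSet_refBox (n : ℕ) : MeasurableSet (refBox n) :=
  measurableSet_prism (measurableSet_Icc.prod measurableSet_Icc)

lemma integral_rect_triangles_sub_squares :
    ∫ p in Set.Icc (0 : ℝ) 2 ×ˢ Set.Icc (0 : ℝ) 1,
      (((p.1 * p.2 - (max 0 (p.1 / 2 + p.2 - 1)) ^ 2) ^ 2 +
        ((max 0 (p.1 / 2 + p.2 - 1)) ^ 2) ^ 2) -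
        ((min 1 p.1 * p.2) ^ 2 + (max (p.1 - 1) 0 * p.2) ^ 2)) = 2 / 45 := by
  rw [integral_sub, integral_rect_triangles, integral_rect_squares]
  · norm_num
  all_goals
    exact ContinuousOn.integrableOn_compact (isCompact_Icc.prod isCompact_Icc)
      (Continuous.continuousOn (by fun_prop))

/-- Values of the four cell functions on the reference box. -/
lemma vol_tiles_inter_Iic {n : ℕ} {y : Fin (n + 2) → ℝ} (hy : y ∈ refBox n) :
    vol (prism n (Set.Icc 0 1 ×ˢ Set.Icc 0 1) ∩ Set.Iic y) =
        (min 1 (y 0) * y 1) * ∏ k : Fin n, y k.succ.succ ∧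
    vol (prism n (Set.Icc 1 2 ×ˢ Set.Icc 0 1) ∩ Set.Iic y) =
        (max (y 0 - 1) 0 * y 1) * ∏ k : Fin n, y k.succ.succ ∧
    vol (prism n triA ∩ Set.Iic y) =
        (y 0 * y 1 - (max 0 (y 0 / 2 + y 1 - 1)) ^ 2) * ∏ k : Fin n, y k.succ.succ ∧
    vol (prism n triB ∩ Set.Iic y) =
        (max 0 (y 0 / 2 + y 1 - 1)) ^ 2 * ∏ k : Fin n, y k.succ.succ := by
  obtain ⟨⟨h1, h2⟩, h3, h4⟩ := (mem_refBox.1 hy).1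
  simp only [vol_prism_inter_Iic _ hy, volume_rect_inter_Iic h3 h4,
    volume_triA_inter_Iic h1 h2 h3 h4, volume_triB_inter_Iic h2 h4, min_eq_right h2, sub_zero,
    max_eq_left (le_min zero_le_one h1), and_self]

/-- Replacing the two jittered cubes whose union is `I = [1−2/m,1] × [1−1/m,1]^{d−1}`
by the two triangular prisms decreases the mean squared L2-discrepancy by exactly
`(2/5)·3^{−d}·m^{−3d} > 0`. -/
theorem jittered_sub_modified_meanL2sq (d m : ℕ) (hd : 2 ≤ d) (hm : 2 ≤ m)
    (Ωmod : (Fin d → Fin m) → Set (Fin d → ℝ))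
    (hA : Ωmod (idxA d m hm) = prismA d m hd)
    (hB : Ωmod (idxB d m hm) = prismB d m hd)
    (hrest : ∀ j, j ≠ idxA d m hm → j ≠ idxB d m hm → Ωmod j = jitteredCube m j) :
    meanL2sq (Set.Icc (0 : Fin d → ℝ) 1) (jitteredCube m) -
        meanL2sq (Set.Icc (0 : Fin d → ℝ) 1) Ωmod =
      (2 / 5) * ((3 : ℝ) ^ d)⁻¹ * ((m : ℝ) ^ (3 * d))⁻¹ ∧
      (0 : ℝ) < (2 / 5) * ((3 : ℝ) ^ d)⁻¹ * ((m : ℝ) ^ (3 * d))⁻¹ := by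
  obtain ⟨n, rfl⟩ : ∃ n, d = n + 2 := ⟨d - 2, by omega⟩
  have hm0 : (0 : ℝ) < m := by positivity
  refine ⟨?_, by positivity⟩
  have : Nonempty (Fin (n + 2) → Fin m) := ⟨idxA (n + 2) m hm⟩
  have tA := isUnitTile_triA
  have tB := isUnitTile_triB
  have sA : IsUnitTile (Set.Icc 0 1 ×ˢ Set.Icc 0 1) :=
    isUnitTile_rect le_rfl one_le_two (by norm_num)
  have sB : IsUnitTile (Set.Icc 1 2 ×ˢ Set.Icc 0 1) :=
    isUnitTile_rect zero_le_one le_rfl (by norm_num)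
  rw [prismA_eq hm hd] at hA
  rw [prismB_eq hm hd] at hB
  have hcell : ∀ j, IsCell (jitteredCube m j : Set (Fin (n + 2) → ℝ)) := fun j =>
    isCell_jitteredCube (by omega) j
  have hcell' : ∀ j, IsCell (Ωmod j) := fun j => by
    by_cases ha : j = idxA (n + 2) m hm
    · rw [ha, hA]; exact tA.isCell hm0
    by_cases hb : j = idxB (n + 2) m hm
    · rw [hb, hB]; exact tB.isCell hm0
    rw [hrest j ha hb]; exact hcell j
  have hzero : ∀ {T : Set (ℝ × ℝ)}, IsUnitTile T → ∀ x ∈ Set.Icc (0 : Fin (n + 2) → ℝ) 1,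
      refMap n m x ∉ refBox n → vol (prism n T ∩ Set.Iic (refMap n m x)) = 0 :=
    fun hT x hx hy => vol_prism_inter_Iic_of_notMem hT.subset hy (refMap_mem_bounds hx).1
      (refMap_mem_bounds hx).2
  have hvolK : vol (Set.Icc (0 : Fin (n + 2) → ℝ) 1) = 1 := by
    rw [vol, Real.volume_Icc_pi_toReal zero_le_one]
    simp
  rw [meanL2sq_sub_of_two_changed hcell hcell' measurableSet_Icc isCompact_Icc.measure_ne_top
    (idxA_ne_idxB hm) hrest]
  · simp only [sA.qfun_eq hm0 (jitteredCube_idxA hm), sB.qfun_eq hm0 (jitteredCube_idxB hm),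
      tA.qfun_eq hm0 hA, tB.qfun_eq hm0 hB]
    let f : ℝ × ℝ → ℝ := fun p =>
      ((p.1 * p.2 - (max 0 (p.1 / 2 + p.2 - 1)) ^ 2) ^ 2 + ((max 0 (p.1 / 2 + p.2 - 1)) ^ 2) ^ 2) -
        ((min 1 p.1 * p.2) ^ 2 + (max (p.1 - 1) 0 * p.2) ^ 2)
    let H : (Fin (n + 2) → ℝ) → ℝ := fun y =>
      f (y 0, y 1) * (∏ k : Fin n, y k.succ.succ) ^ 2
    have hint : ∀ x, (Set.Icc (0 : Fin (n + 2) → ℝ) 1).indicator (fun x =>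
        ((vol (prism n triA ∩ Set.Iic (refMap n m x)) ^ 2 +
          vol (prism n triB ∩ Set.Iic (refMap n m x)) ^ 2) -
        (vol (prism n (Set.Icc 0 1 ×ˢ Set.Icc 0 1) ∩ Set.Iic (refMap n m x)) ^ 2 +
          vol (prism n (Set.Icc 1 2 ×ˢ Set.Icc 0 1) ∩ Set.Iic (refMap n m x)) ^ 2))) x =
        (refBox n).indicator H (refMap n m x) := by
      intro x
      by_cases hy : refMap n m x ∈ refBox n
      · obtain ⟨h1, h2, h3, h4⟩ := vol_tiles_inter_Iic hy
        rw [Set.indicator_of_mem hy, Set.indicator_of_mem (preimage_refBox_subset hm hy),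
          h1, h2, h3, h4]
        simp only [H, f]
        ring
      · rw [Set.indicator_of_notMem hy]
        by_cases hx : x ∈ Set.Icc (0 : Fin (n + 2) → ℝ) 1
        · rw [Set.indicator_of_mem hx, hzero tA x hx hy, hzero tB x hx hy, hzero sA x hx hy,
            hzero sB x hx hy]
          norm_num
        · rw [Set.indicator_of_notMem hx]
    rw [← integral_indicator measurableSet_Icc, integral_congr_ae (ae_of_all _ hint),
      integral_comp_refMap hm0, integral_indicator (measurableSet_refBox n),
      integral_refBox_mul, integral_rect_triangles_sub_squares, hvolK]
    simp only [Fintype.card_pi, Fintype.card_fin, Finset.prod_const, Finset.card_univ,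
      Nat.cast_pow]
    rw [pow_add 3 n 2, show 3 * (n + 2) = (n + 2) * 2 + (n + 2) by ring, pow_add _ ((n + 2) * 2),
      pow_mul]
    field_simp
    norm_num
  · intro x hx
    simp only [sA.qfun_eq hm0 (jitteredCube_idxA hm), sB.qfun_eq hm0 (jitteredCube_idxB hm),
      tA.qfun_eq hm0 hA, tB.qfun_eq hm0 hB]
    by_cases hy : refMap n m x ∈ refBox n
    · obtain ⟨h1, h2, h3, h4⟩ := vol_tiles_inter_Iic hy
      rw [h1, h2, h3, h4, ← add_mul, ← add_mul, ← add_mul]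
      congr 1
      rw [sub_add_cancel]
      congr 1
      rcases le_total (refMap n m x 0) 1 with h | h
      · rw [min_eq_right h, max_eq_right (sub_nonpos.2 h), add_zero]
      · rw [min_eq_left h, max_eq_left (sub_nonneg.2 h), add_sub_cancel]
    · rw [hzero tA x hx hy, hzero tB x hx hy, hzero sA x hx hy, hzero sB x hx hy]

end StratifiedSampling
end
end

section
/- Let m ≥ 2, and let z_1 ∈ {0, 1/m, …, (m−2)/m} and z_2 ∈ {0, 1/m, …, (m−1)/m}. Let Ω be the jittered partition of [0,1]² into m² congruent axis-aligned squares of side 1/m, and let Ω̃ be the partition obtained from Ω by replacing the two squares whose union is the rectangle I = [1−z_1−2/m, 1−z_1] × [1−z_2−1/m, 1−z_2] by the two triangles Ω̃_1 = conv{(1−z_1−2/m, 1−z_2−1/m), (1−z_1, 1−z_2−1/m), (1−z_1−2/m, 1−z_2)} and Ω̃_2 = I ∖ int(Ω̃_1). Then E L2²(P_Ω) − E L2²(P_Ω̃) = (2/45)·m^{−6} + (1/15)·z_1·m^{−5} − (1/5)·z_2·m^{−5}. -/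
open MeasureTheory ProbabilityTheory

noncomputable section

namespace StratifiedSampling

/-- The rectangle `I = [1−z₁−2/m, 1−z₁] × [1−z₂−1/m, 1−z₂]`, where `z₁ = j/m`,
`z₂ = k/m`. -/
def rectI (m j k : ℕ) : Set (Fin 2 → ℝ) :=
  Set.Icc ![1 - (j : ℝ) / m - 2 / m, 1 - (k : ℝ) / m - 1 / m]
    ![1 - (j : ℝ) / m, 1 - (k : ℝ) / m]

/-- The triangle `conv{(1−z₁−2/m, 1−z₂−1/m), (1−z₁, 1−z₂−1/m), (1−z₁−2/m, 1−z₂)}`. -/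
def tri₁ (m j k : ℕ) : Set (Fin 2 → ℝ) :=
  convexHull ℝ {![1 - (j : ℝ) / m - 2 / m, 1 - (k : ℝ) / m - 1 / m],
    ![1 - (j : ℝ) / m, 1 - (k : ℝ) / m - 1 / m],
    ![1 - (j : ℝ) / m - 2 / m, 1 - (k : ℝ) / m]}

/-- The complementary triangle `I ∖ int(tri₁)`. -/
def tri₂ (m j k : ℕ) : Set (Fin 2 → ℝ) := rectI m j k \ interior (tri₁ m j k)

/-- Multi-index of the left of the two replaced jittered squares. -/
def idxL (m j k : ℕ) (hm : 2 ≤ m) (hj : j ≤ m - 2) (hk : k ≤ m - 1) : Fin 2 → Fin m :=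
  fun i => if (i : ℕ) = 0 then ⟨m - 2 - j, by omega⟩ else ⟨m - 1 - k, by omega⟩

/-- Multi-index of the right of the two replaced jittered squares. -/
def idxR (m j k : ℕ) (hm : 2 ≤ m) (hj : j ≤ m - 2) (hk : k ≤ m - 1) : Fin 2 → Fin m :=
  fun i => if (i : ℕ) = 0 then ⟨m - 1 - j, by omega⟩ else ⟨m - 1 - k, by omega⟩

section Moments

variable {d : ℕ} {ι : Type} {K : Set (Fin d → ℝ)} {Ω Ω' : ι → Set (Fin d → ℝ)}

lemma isProbabilityMeasure_cond_of_vol_pos (hΩ : ∀ i, 0 < vol (Ω i)) (i : ι) :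
    IsProbabilityMeasure (ProbabilityTheory.cond volume (Ω i)) := by
  obtain ⟨h0, h1⟩ := ENNReal.toReal_pos_iff.1 (hΩ i)
  exact cond_isProbabilityMeasure_of_finite h0.ne' h1.ne

variable [Fintype ι]

lemma isProbabilityMeasure_stratDist (hΩ : ∀ i, 0 < vol (Ω i)) :
    IsProbabilityMeasure (stratDist Ω) := by
  have := isProbabilityMeasure_cond_of_vol_pos hΩ
  unfold stratDist
  infer_instance

lemma integral_indicator_Iic (hΩ : ∀ i, 0 < vol (Ω i)) (x : Fin d → ℝ) (i : ι) :
    ∫ p, Set.indicator (Set.Iic x) (fun _ => (1 : ℝ)) (p i) ∂(stratDist Ω) = qfun Ω i x := by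
  have := isProbabilityMeasure_cond_of_vol_pos hΩ
  have h := (measurePreserving_eval (fun i => ProbabilityTheory.cond volume (Ω i)) i)
  have hm : Measurable (Set.indicator (Set.Iic x) (fun _ => (1 : ℝ))) :=
    measurable_const.indicator measurableSet_Iic
  have h2 := integral_map (μ := Measure.pi fun i => ProbabilityTheory.cond volume (Ω i))
    h.measurable.aemeasurable hm.aestronglyMeasurable
  rw [h.map_eq] at h2
  unfold stratDist
  refine h2.symm.trans ?_
  rw [integral_indicator measurableSet_Iic]
  simp only [integral_const, smul_eq_mul, mul_one, measureReal_restrict_apply_univ]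
  rw [measureReal_def, cond_apply' measurableSet_Iic, qfun, vol, vol, ENNReal.toReal_mul,
    ENNReal.toReal_inv]
  ring

lemma integral_countIn_sq_and_mean (hΩ : ∀ i, 0 < vol (Ω i)) (x : Fin d → ℝ) :
    Integrable (fun p => countIn p x) (stratDist Ω) ∧
    Integrable (fun p => countIn p x ^ 2) (stratDist Ω) ∧
    ∫ p, countIn p x ∂(stratDist Ω) = ∑ i, qfun Ω i x ∧
    ∫ p, countIn p x ^ 2 ∂(stratDist Ω) =
      ∑ i, (qfun Ω i x - qfun Ω i x ^ 2) + (∑ i, qfun Ω i x) ^ 2 := by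
  have := isProbabilityMeasure_cond_of_vol_pos hΩ
  have := isProbabilityMeasure_stratDist hΩ
  set Y : ι → (ι → Fin d → ℝ) → ℝ :=
    fun i p => Set.indicator (Set.Iic x) (fun _ => (1 : ℝ)) (p i) with hY
  have hm : Measurable (Set.indicator (Set.Iic x) (fun _ => (1 : ℝ))) :=
    measurable_const.indicator measurableSet_Iic
  have hYm : ∀ i, Measurable (Y i) := fun i => hm.comp (measurable_pi_apply i)
  have hYL : ∀ i, MemLp (Y i) 2 (stratDist Ω) := fun i =>
    MemLp.of_bound (hYm i).aestronglyMeasurable 1 (Filter.Eventually.of_forall fun p => by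
      by_cases h : p i ∈ Set.Iic x <;> simp [hY, Set.indicator, h])
  have hindep : iIndepFun Y (stratDist Ω) :=
    iIndepFun_pi (X := fun _ => Set.indicator (Set.Iic x) (fun _ => (1 : ℝ)))
      fun i => hm.aemeasurable
  have hsum : (fun p : ι → Fin d → ℝ => countIn p x) = ∑ i, Y i := by
    ext p; simp [countIn, hY]
  have hSL : MemLp (∑ i, Y i) 2 (stratDist Ω) := memLp_finsetSum' _ fun i _ => hYL i
  have hmean : ∫ p, (∑ i, Y i) p ∂(stratDist Ω) = ∑ i, qfun Ω i x := by
    simp only [Finset.sum_apply]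
    rw [integral_finsetSum _ fun i _ => (hYL i).integrable one_le_two]
    exact Finset.sum_congr rfl fun i _ => integral_indicator_Iic hΩ x i
  have hvar : ∀ i, Var[Y i; stratDist Ω] = qfun Ω i x - qfun Ω i x ^ 2 := by
    intro i
    have hsq : Y i ^ 2 = Y i := by
      ext p
      by_cases h : p i ∈ Set.Iic x <;> simp [hY, Set.indicator, h]
    rw [variance_eq_sub (hYL i), hsq, integral_indicator_Iic hΩ x i]
  have hvs := IndepFun.variance_sum (s := Finset.univ) (fun i _ => hYL i)
    (fun i _ j _ hij => hindep.indepFun hij)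
  rw [variance_eq_sub hSL, hmean, Finset.sum_congr rfl fun i _ => hvar i] at hvs
  have hsq : (fun p : ι → Fin d → ℝ => countIn p x ^ 2) = (∑ i, Y i) ^ 2 := by
    rw [← hsum]; rfl
  rw [hsq, hsum]
  refine ⟨hSL.integrable one_le_two, hSL.integrable_sq, hmean, ?_⟩
  linarith

/-- Bias-variance decomposition of the squared discrepancy at a fixed point. -/
lemma integral_discrep_sq (hΩ : ∀ i, 0 < vol (Ω i)) (x : Fin d → ℝ) :
    ∫ p, discrep K p x ^ 2 ∂(stratDist Ω) =
      (∑ i, (qfun Ω i x - qfun Ω i x ^ 2)) / (Fintype.card ι : ℝ) ^ 2 +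
        ((∑ i, qfun Ω i x) / (Fintype.card ι : ℝ) - vol (K ∩ Set.Iic x) / vol K) ^ 2 := by
  have := isProbabilityMeasure_stratDist hΩ
  obtain ⟨hi, hi2, h1, h2⟩ := integral_countIn_sq_and_mean hΩ x
  set N : ℝ := (Fintype.card ι : ℝ)
  set c := vol (K ∩ Set.Iic x) / vol K
  have hexp : ∀ p : ι → Fin d → ℝ, discrep K p x ^ 2 =
      countIn p x ^ 2 * (1 / N ^ 2) - countIn p x * (2 * c / N) + c ^ 2 := by
    intro p
    change (countIn p x / N - c) ^ 2 = _
    ring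
  simp_rw [hexp]
  rw [integral_add (by exact (hi2.mul_const _).sub (hi.mul_const _)) (integrable_const _),
    integral_sub (hi2.mul_const _) (hi.mul_const _), integral_mul_const, integral_mul_const,
    h1, h2]
  simp only [integral_const, probReal_univ, smul_eq_mul, one_mul]
  ring

lemma measurable_uncurry_discrep (hK : MeasurableSet K) :
    Measurable fun z : (ι → Fin d → ℝ) × (Fin d → ℝ) => discrep K z.1 z.2 := by
  unfold discrep countIn vol
  refine Measurable.sub (Measurable.div_const (Finset.measurable_sum _ fun i _ => ?_) _)
    (Measurable.div_const ?_ _)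
  · have hs : MeasurableSet {z : (ι → Fin d → ℝ) × (Fin d → ℝ) | z.1 i ≤ z.2} :=
      measurableSet_le ((measurable_pi_apply i).comp measurable_fst) measurable_snd
    exact (measurable_const (a := (1 : ℝ))).indicator hs
  · have hs : MeasurableSet {z : (Fin d → ℝ) × (Fin d → ℝ) | z.2 ∈ K ∧ z.2 ≤ z.1} :=
      (measurable_snd hK).inter (measurableSet_le measurable_snd measurable_fst)
    exact ((measurable_measure_prodMk_left (ν := volume) hs).comp measurable_snd).ennreal_toReal

lemma abs_discrep_le (hK : volume K ≠ ⊤) (p : ι → Fin d → ℝ) (x : Fin d → ℝ) :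
    |discrep K p x| ≤ 1 := by
  have h1 : countIn p x ≤ Fintype.card ι := by
    calc countIn p x ≤ ∑ _i : ι, (1 : ℝ) := Finset.sum_le_sum fun i _ => by
          by_cases h : p i ∈ Set.Iic x <;> simp [Set.indicator, h]
      _ = _ := by simp
  have h0 : 0 ≤ countIn p x := Finset.sum_nonneg fun i _ =>
    Set.indicator_nonneg (fun _ _ => zero_le_one) _
  have h2 : vol (K ∩ Set.Iic x) ≤ vol K :=
    ENNReal.toReal_mono hK (measure_mono Set.inter_subset_left)
  have h3 : 0 ≤ vol (K ∩ Set.Iic x) := ENNReal.toReal_nonneg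
  have h4 := div_le_one_of_le₀ h1 (Nat.cast_nonneg _)
  have h5 := div_le_one_of_le₀ h2 (h3.trans h2)
  have h6 : 0 ≤ countIn p x / (Fintype.card ι : ℝ) := by positivity
  have h7 := div_nonneg h3 (h3.trans h2)
  rw [discrep, abs_le]
  constructor <;> linarith

lemma integrable_uncurry_discrep_sq (hΩ : ∀ i, 0 < vol (Ω i)) (hK : MeasurableSet K)
    (hKt : volume K ≠ ⊤) :
    Integrable (Function.uncurry fun p x => discrep K p x ^ 2)
      ((stratDist Ω).prod (volume.restrict K)) := by
  have := isProbabilityMeasure_stratDist hΩ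
  have : IsFiniteMeasure (volume.restrict K) := isFiniteMeasure_restrict.2 hKt
  refine Integrable.of_bound
    ((measurable_uncurry_discrep hK).pow_const 2).aestronglyMeasurable 1
    (Filter.Eventually.of_forall fun z => ?_)
  simpa [Function.uncurry] using abs_discrep_le hKt z.1 z.2

/-- If the mean counting functions of two stratified samples agree, then the mean squared
discrepancies differ by the integral of the difference of the sums of `qfun ^ 2`. -/
lemma meanL2sq_sub_meanL2sq (hΩ : ∀ i, 0 < vol (Ω i)) (hΩ' : ∀ i, 0 < vol (Ω' i))
    (hK : MeasurableSet K) (hKt : volume K ≠ ⊤)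
    (hq : ∀ x, ∑ i, qfun Ω i x = ∑ i, qfun Ω' i x) :
    meanL2sq K Ω - meanL2sq K Ω' = (1 / vol K) *
      ∫ x in K, (∑ i, (qfun Ω' i x ^ 2 - qfun Ω i x ^ 2)) / (Fintype.card ι : ℝ) ^ 2 := by
  have := isProbabilityMeasure_stratDist hΩ
  have := isProbabilityMeasure_stratDist hΩ'
  have hI := integrable_uncurry_discrep_sq hΩ hK hKt
  have hI' := integrable_uncurry_discrep_sq hΩ' hK hKt
  rw [meanL2sq, meanL2sq, integral_const_mul, integral_const_mul, integral_integral_swap hI,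
    integral_integral_swap hI', ← mul_sub]
  congr 1
  refine (integral_sub hI.integral_prod_right hI'.integral_prod_right).symm.trans ?_
  refine integral_congr_ae (Filter.Eventually.of_forall fun x => ?_)
  simp only [Function.uncurry_apply_pair, integral_discrep_sq hΩ, integral_discrep_sq hΩ', Finset.sum_sub_distrib, hq]
  ring

end Moments

section Geometry

lemma vol_Icc_inter_Iic (a b c e : ℝ) (x : Fin 2 → ℝ) :
    vol (Set.Icc ![a, b] ![c, e] ∩ Set.Iic x) =
      max 0 (min c (x 0) - a) * max 0 (min e (x 1) - b) := by
  have h : Set.Icc ![a, b] ![c, e] ∩ Set.Iic x = Set.Icc ![a, b] ![min c (x 0), min e (x 1)] := by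
    ext p
    simp only [Set.mem_inter_iff, Set.mem_Icc, Set.mem_Iic, Pi.le_def, Fin.forall_fin_two,
      Matrix.cons_val_zero, Matrix.cons_val_one, le_min_iff]
    tauto
  rw [vol, h, Real.volume_Icc_pi]
  simp [Fin.prod_univ_two, ENNReal.toReal_ofReal', max_comm]

/-- Area of a right triangle whose legs are parallel to the axes, with hypotenuse of
slope `-1/2`. -/
lemma vol_upper_triangle (X Y e : ℝ) :
    vol {p : Fin 2 → ℝ | p 0 ≤ X ∧ p 1 ≤ Y ∧ e < p 0 / 2 + p 1} =
      max 0 (X / 2 + Y - e) ^ 2 := by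
  set S : Set (ℝ × ℝ) := {p | p.1 ≤ X ∧ p.2 ≤ Y ∧ e < p.1 / 2 + p.2} with hS
  have hSm : MeasurableSet S := by
    refine (measurableSet_le measurable_fst measurable_const).inter
      ((measurableSet_le measurable_snd measurable_const).inter
        (measurableSet_lt (measurable_const (a := e))
          ((measurable_fst.div_const 2).add measurable_snd)))
  have hvol : volume {p : Fin 2 → ℝ | p 0 ≤ X ∧ p 1 ≤ Y ∧ e < p 0 / 2 + p 1} = volume S :=
    (volume_preserving_finTwoArrow ℝ).measure_preimage_equiv S
  have hslice : ∀ s, volume (Prod.mk s ⁻¹' S) =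
      (Set.Ioc (2 * (e - Y)) X).indicator (fun s => ENNReal.ofReal (Y - e + s / 2)) s := by
    intro s
    by_cases hs : s ∈ Set.Ioc (2 * (e - Y)) X
    · rw [Set.indicator_of_mem hs]
      have : Prod.mk s ⁻¹' S = Set.Ioc (e - s / 2) Y := by
        ext y
        simp only [hS, Set.mem_preimage, Set.mem_ofPred_eq, Set.mem_Ioc]
        constructor
        · rintro ⟨-, h1, h2⟩; constructor <;> linarith
        · rintro ⟨h1, h2⟩; exact ⟨hs.2, h2, by linarith⟩
      rw [this, Real.volume_Ioc]
      congr 1; ring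
    · rw [Set.indicator_of_notMem hs]
      have : Prod.mk s ⁻¹' S = ∅ := by
        ext y
        simp only [hS, Set.mem_preimage, Set.mem_ofPred_eq, Set.mem_empty_iff_false, iff_false]
        rintro ⟨h0, h1, h2⟩
        exact hs ⟨by linarith, h0⟩
      rw [this, measure_empty]
  rw [vol, hvol, Measure.volume_eq_prod, Measure.prod_apply hSm]
  simp_rw [hslice]
  rw [lintegral_indicator measurableSet_Ioc]
  rcases le_total X (2 * (e - Y)) with hle | hle
  · rw [Set.Ioc_eq_empty (not_lt.2 hle), max_eq_left (by linarith)]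
    simp
  · rw [← ofReal_integral_eq_lintegral_ofReal, ← intervalIntegral.integral_of_le hle,
      ENNReal.toReal_ofReal, max_eq_right (by linarith)]
    · simp only [intervalIntegral.integral_add, intervalIntegral.integral_div,
        intervalIntegral.integral_const, integral_id, smul_eq_mul,
        intervalIntegrable_const, intervalIntegral.intervalIntegrable_id,
        IntervalIntegrable.div_const]
      ring
    · exact intervalIntegral.integral_nonneg hle fun s hs => by linarith [hs.1]
    · exact (Continuous.integrableOn_Icc (by fun_prop)).mono_set Set.Ioc_subset_Icc_self
    · exact (ae_restrict_iff' measurableSet_Ioc).2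
        (Filter.Eventually.of_forall fun s hs => by
          have := hs.1
          simp only [Pi.zero_apply]
          linarith)

lemma convexHull_right_triangle {a b h : ℝ} (hh : 0 < h) :
    convexHull ℝ {![a, b], ![a + 2 * h, b], ![a, b + h]} =
      {p : Fin 2 → ℝ | a ≤ p 0 ∧ b ≤ p 1 ∧ p 0 / 2 + p 1 ≤ a / 2 + b + h} := by
  apply Set.Subset.antisymm
  · refine convexHull_min ?_ ?_
    · rintro p (rfl | rfl | rfl) <;>
        simp only [Set.mem_ofPred_eq, Matrix.cons_val_zero, Matrix.cons_val_one] <;>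
        refine ⟨?_, ?_, ?_⟩ <;> linarith
    · rintro p ⟨hp0, hp1, hp⟩ q ⟨hq0, hq1, hq⟩ s t hs ht hst
      simp only [Set.mem_ofPred_eq, Pi.add_apply, Pi.smul_apply, smul_eq_mul]
      obtain rfl : t = 1 - s := by linarith
      refine ⟨?_, ?_, ?_⟩ <;> nlinarith
  · rintro p ⟨hp0, hp1, hp⟩
    have hs := (convex_convexHull ℝ {![a, b], ![a + 2 * h, b], ![a, b + h]}).sum_mem
      (t := Finset.univ)
      (w := ![1 - (p 0 - a) / (2 * h) - (p 1 - b) / h, (p 0 - a) / (2 * h), (p 1 - b) / h])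
      (z := ![![a, b], ![a + 2 * h, b], ![a, b + h]]) ?_ ?_ ?_
    · convert hs using 1
      ext i
      fin_cases i <;> simp [Fin.sum_univ_three] <;> field_simp <;> ring
    · intro i _
      fin_cases i
      · have : 1 - (p 0 - a) / (2 * h) - (p 1 - b) / h =
            (a / 2 + b + h - (p 0 / 2 + p 1)) / h := by field_simp; ring
        simp only [Fin.zero_eta, Matrix.cons_val_zero, this]
        exact div_nonneg (by linarith) hh.le
      · exact div_nonneg (by linarith) (by linarith)
      · exact div_nonneg (by linarith) hh.le
    · simp only [Fin.sum_univ_three, Matrix.cons_val]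
      ring
    · intro i _
      refine subset_convexHull ℝ _ ?_
      fin_cases i <;> simp

lemma vol_Icc_diff_interior_triangle_inter_Iic {a b h : ℝ} (hh : 0 < h) (x : Fin 2 → ℝ) :
    vol ((Set.Icc ![a, b] ![a + 2 * h, b + h] \
        interior (convexHull ℝ {![a, b], ![a + 2 * h, b], ![a, b + h]})) ∩ Set.Iic x) =
      max 0 (min (a + 2 * h) (x 0) / 2 + min (b + h) (x 1) - (a / 2 + b + h)) ^ 2 := by
  rw [← vol_upper_triangle, vol, vol]
  congr 1
  have hae : interior (convexHull ℝ {![a, b], ![a + 2 * h, b], ![a, b + h]}) =ᵐ[volume]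
      convexHull ℝ {![a, b], ![a + 2 * h, b], ![a, b + h]} :=
    interior_ae_eq_of_null_frontier ((convex_convexHull ℝ _).addHaar_frontier volume)
  rw [measure_congr (((Filter.EventuallyEq.refl _ _).diff hae).inter
    (Filter.EventuallyEq.refl _ (Set.Iic x))), convexHull_right_triangle hh]
  congr 1
  ext p
  simp only [Set.mem_inter_iff, Set.mem_sdiff, Set.mem_Icc, Set.mem_Iic, Pi.le_def,
    Fin.forall_fin_two, Matrix.cons_val_zero, Matrix.cons_val_one, Set.mem_ofPred_eq,
    le_min_iff, not_and, not_le]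
  constructor
  · rintro ⟨⟨⟨⟨h1, h2⟩, h3, h4⟩, h5⟩, h6, h7⟩
    exact ⟨⟨h3, h6⟩, ⟨h4, h7⟩, h5 h1 h2⟩
  · rintro ⟨⟨h3, h6⟩, ⟨h4, h7⟩, h5⟩
    exact ⟨⟨⟨⟨by linarith, by linarith⟩, h3, h4⟩, fun _ _ => h5⟩, h6, h7⟩

lemma vol_triangle_inter_Iic {a b h : ℝ} (hh : 0 < h) (x : Fin 2 → ℝ) :
    vol (convexHull ℝ {![a, b], ![a + 2 * h, b], ![a, b + h]} ∩ Set.Iic x) =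
      max 0 (min (a + 2 * h) (x 0) - a) * max 0 (min (b + h) (x 1) - b) -
      max 0 (min (a + 2 * h) (x 0) / 2 + min (b + h) (x 1) - (a / 2 + b + h)) ^ 2 := by
  rw [← vol_Icc_inter_Iic, ← vol_Icc_diff_interior_triangle_inter_Iic hh, eq_sub_iff_add_eq]
  set R := Set.Icc ![a, b] ![a + 2 * h, b + h]
  set C := convexHull ℝ {![a, b], ![a + 2 * h, b], ![a, b + h]} with hC
  have hae : interior C =ᵐ[volume] C :=
    interior_ae_eq_of_null_frontier ((convex_convexHull ℝ _).addHaar_frontier volume)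
  have hCR : C ⊆ R := by
    rw [hC, convexHull_right_triangle hh]
    rintro p ⟨h1, h2, h3⟩
    simp only [R, Set.mem_Icc, Pi.le_def, Fin.forall_fin_two, Matrix.cons_val_zero,
      Matrix.cons_val_one]
    exact ⟨⟨h1, h2⟩, by linarith, by linarith⟩
  have hfin : volume (R ∩ Set.Iic x) ≠ ⊤ :=
    ((measure_mono Set.inter_subset_left).trans_lt isCompact_Icc.measure_lt_top).ne
  have h1 : volume (C ∩ Set.Iic x) = volume (R ∩ Set.Iic x ∩ interior C) := by
    rw [measure_congr (hae.symm.inter (Filter.EventuallyEq.refl _ (Set.Iic x)))]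
    congr 1
    ext p
    constructor
    · rintro ⟨h1, h2⟩; exact ⟨⟨hCR (interior_subset h1), h2⟩, h1⟩
    · rintro ⟨⟨-, h2⟩, h1⟩; exact ⟨h1, h2⟩
  have h2 : (R \ interior C) ∩ Set.Iic x = (R ∩ Set.Iic x) \ interior C := by
    ext p; simp only [Set.mem_inter_iff, Set.mem_sdiff]; tauto
  rw [vol, vol, vol, h1, h2,
    ← measure_inter_add_sdiff (R ∩ Set.Iic x) isOpen_interior.measurableSet,
    ENNReal.toReal_add (measure_ne_top_of_subset Set.inter_subset_left hfin)
      (measure_ne_top_of_subset Set.sdiff_subset hfin)]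

end Geometry

section Integration

lemma max_zero_min_sub {a h c x : ℝ} (hh : 0 < h) :
    max 0 (min (a + c * h) x - a) = h * max 0 (min c ((x - a) / h)) := by
  rw [mul_max_of_nonneg _ _ hh.le, mul_min_of_nonneg _ _ hh.le, mul_zero,
    ← min_sub_sub_right, mul_div_cancel₀ _ hh.ne']
  ring_nf

lemma integral_comp_clamp {F : ℝ → ℝ} (hF : Continuous F) (hF0 : F 0 = 0) {a h c : ℝ}
    (ha : 0 ≤ a) (hh : 0 < h) (hc : 0 ≤ c) (hach : a + c * h ≤ 1) :
    ∫ x in (0 : ℝ)..1, F (max 0 (min c ((x - a) / h))) =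
      h * (∫ u in (0 : ℝ)..c, F u) + (1 - (a + c * h)) * F c := by
  have hcont : Continuous fun x => F (max 0 (min c ((x - a) / h))) := by fun_prop
  have hi := fun s t : ℝ => hcont.intervalIntegrable (μ := volume) s t
  have hch : 0 ≤ c * h := by positivity
  rw [← intervalIntegral.integral_add_adjacent_intervals (hi 0 a) (hi a 1),
    ← intervalIntegral.integral_add_adjacent_intervals (hi a (a + c * h)) (hi (a + c * h) 1)]
  have h1 : ∫ x in (0 : ℝ)..a, F (max 0 (min c ((x - a) / h))) = 0 := by
    refine (intervalIntegral.integral_congr fun x hx => ?_).trans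
      (intervalIntegral.integral_zero (E := ℝ))
    rw [Set.uIcc_of_le ha] at hx
    have : (x - a) / h ≤ 0 := div_nonpos_of_nonpos_of_nonneg (by linarith [hx.2]) hh.le
    rw [max_eq_left ((min_le_right _ _).trans this), hF0]
  have h2 : ∫ x in a..(a + c * h), F (max 0 (min c ((x - a) / h))) =
      h * ∫ u in (0 : ℝ)..c, F u := by
    have hs := intervalIntegral.integral_comp_div_sub (a := a) (b := a + c * h) F hh.ne' (a / h)
    have e1 : a / h - a / h = 0 := sub_self _
    have e2 : (a + c * h) / h - a / h = c := by field_simp; ring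
    rw [e1, e2, smul_eq_mul] at hs
    rw [← hs]
    refine intervalIntegral.integral_congr fun x hx => ?_
    rw [Set.uIcc_of_le (by linarith)] at hx
    rw [← sub_div, min_eq_right ((div_le_iff₀ hh).2 (by linarith [hx.2])),
      max_eq_right (div_nonneg (by linarith [hx.1]) hh.le)]
  have h3 : ∫ x in (a + c * h)..1, F (max 0 (min c ((x - a) / h))) =
      (1 - (a + c * h)) * F c := by
    rw [← smul_eq_mul (1 - (a + c * h)), ← intervalIntegral.integral_const]
    refine intervalIntegral.integral_congr fun x hx => ?_
    rw [Set.uIcc_of_le hach] at hx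
    rw [min_eq_left ((le_div_iff₀ hh).2 (by linarith [hx.1])), max_eq_right hc]
  rw [h1, h2, h3, zero_add]

lemma integral_quintic (s t c₀ c₁ c₂ c₃ c₄ c₅ : ℝ) :
    ∫ v in s..t, (c₀ + c₁ * v + c₂ * v ^ 2 + c₃ * v ^ 3 + c₄ * v ^ 4 + c₅ * v ^ 5) =
      c₀ * (t - s) + c₁ * ((t ^ 2 - s ^ 2) / 2) + c₂ * ((t ^ 3 - s ^ 3) / 3) +
        c₃ * ((t ^ 4 - s ^ 4) / 4) + c₄ * ((t ^ 5 - s ^ 5) / 5) + c₅ * ((t ^ 6 - s ^ 6) / 6) := by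
  rw [intervalIntegral.integral_eq_sub_of_hasDerivAt
    (f := fun v => c₀ * v + c₁ * (v ^ 2 / 2) + c₂ * (v ^ 3 / 3) + c₃ * (v ^ 4 / 4) +
      c₄ * (v ^ 5 / 5) + c₅ * (v ^ 6 / 6))]
  · ring
  · intro v _
    have hp : ∀ n : ℕ, HasDerivAt (fun v : ℝ => v ^ (n + 1) / (n + 1 : ℝ)) (v ^ n) v := by
      intro n
      have := (hasDerivAt_pow (n + 1) v).div_const ((n : ℝ) + 1)
      refine this.congr_deriv ?_
      rw [Nat.add_sub_cancel]
      push_cast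
      field_simp
    have := (((((((hp 0).const_mul c₀).add ((hp 1).const_mul c₁)).add ((hp 2).const_mul c₂)).add
      ((hp 3).const_mul c₃)).add ((hp 4).const_mul c₄)).add ((hp 5).const_mul c₅))
    refine (this.congr_deriv (by ring)).congr_of_eventuallyEq
      (Filter.Eventually.of_forall fun v => ?_)
    simp only [Pi.add_apply]
    norm_num
  · exact Continuous.intervalIntegrable (by fun_prop) _ _

/-- Difference of the sums of squared counting means of the two triangles and of the two
squares, in coordinates normalised to the rectangle `[0,2] × [0,1]`. -/
def sqGap (u v : ℝ) : ℝ :=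
  (u * v - max 0 (u / 2 + v - 1) ^ 2) ^ 2 + (max 0 (u / 2 + v - 1) ^ 2) ^ 2 -
    ((min 1 u * v) ^ 2 + ((max 1 u - 1) * v) ^ 2)

lemma continuous_uncurry_sqGap : Continuous (Function.uncurry sqGap) := by
  unfold sqGap Function.uncurry
  fun_prop

lemma sqGap_zero_right {u : ℝ} (hu : u ≤ 2) : sqGap u 0 = 0 := by
  rw [sqGap, max_eq_left (by linarith)]
  ring

lemma sqGap_one {u : ℝ} (hu : 0 ≤ u) :
    sqGap u 1 = u ^ 4 / 8 - u ^ 3 / 2 + u ^ 2 - (min 1 u ^ 2 + (max 1 u - 1) ^ 2) := by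
  rw [sqGap, max_eq_right (by linarith)]
  ring

lemma integral_sqGap {u : ℝ} (hu : 0 ≤ u) (hu2 : u ≤ 2) :
    ∫ v in (0 : ℝ)..1, sqGap u v =
      u ^ 2 / 3 - u ^ 4 / 12 + 11 * u ^ 5 / 480 - (min 1 u ^ 2 + (max 1 u - 1) ^ 2) / 3 := by
  set r := min 1 u ^ 2 + (max 1 u - 1) ^ 2 with hr
  have hcont : Continuous (sqGap u) :=
    continuous_uncurry_sqGap.comp (Continuous.prodMk_right u)
  rw [← intervalIntegral.integral_add_adjacent_intervals
    (hcont.intervalIntegrable (μ := volume) 0 (1 - u / 2)) (hcont.intervalIntegrable _ _)]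
  have h1 : ∫ v in (0 : ℝ)..(1 - u / 2), sqGap u v =
      ∫ v in (0 : ℝ)..(1 - u / 2),
        (0 + 0 * v + (u ^ 2 - r) * v ^ 2 + 0 * v ^ 3 + 0 * v ^ 4 + 0 * v ^ 5) := by
    refine intervalIntegral.integral_congr fun v hv => ?_
    rw [Set.uIcc_of_le (by linarith)] at hv
    simp only [sqGap, hr]
    rw [max_eq_left (by linarith [hv.2])]
    ring
  have h2 : ∫ v in (1 - u / 2)..1, sqGap u v =
      ∫ v in (1 - u / 2)..1,
        (2 * (u / 2 - 1) ^ 4 + (8 * (u / 2 - 1) ^ 3 - 2 * u * (u / 2 - 1) ^ 2) * v +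
          (u ^ 2 - r + 12 * (u / 2 - 1) ^ 2 - 4 * u * (u / 2 - 1)) * v ^ 2 +
          (8 * (u / 2 - 1) - 2 * u) * v ^ 3 + 2 * v ^ 4 + 0 * v ^ 5) := by
    refine intervalIntegral.integral_congr fun v hv => ?_
    rw [Set.uIcc_of_le (by linarith)] at hv
    simp only [sqGap, hr]
    rw [max_eq_right (by linarith [hv.1])]
    ring
  rw [h1, h2, integral_quintic, integral_quintic]
  ring

lemma integral_min_one_sq_add_max_one_sq :
    ∫ u in (0 : ℝ)..2, (min 1 u ^ 2 + (max 1 u - 1) ^ 2) = 5 / 3 := by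
  have hcont : Continuous fun u : ℝ => min 1 u ^ 2 + (max 1 u - 1) ^ 2 := by fun_prop
  rw [← intervalIntegral.integral_add_adjacent_intervals
    (hcont.intervalIntegrable (μ := volume) 0 1) (hcont.intervalIntegrable _ _)]
  have h1 : ∫ u in (0 : ℝ)..1, (min 1 u ^ 2 + (max 1 u - 1) ^ 2) =
      ∫ u in (0 : ℝ)..1, (0 + 0 * u + 1 * u ^ 2 + 0 * u ^ 3 + 0 * u ^ 4 + 0 * u ^ 5) := by
    refine intervalIntegral.integral_congr fun u hu => ?_
    rw [Set.uIcc_of_le (by norm_num)] at hu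
    simp only [min_eq_right hu.2, max_eq_left hu.2]
    ring
  have h2 : ∫ u in (1 : ℝ)..2, (min 1 u ^ 2 + (max 1 u - 1) ^ 2) =
      ∫ u in (1 : ℝ)..2, (2 + (-2) * u + 1 * u ^ 2 + 0 * u ^ 3 + 0 * u ^ 4 + 0 * u ^ 5) := by
    refine intervalIntegral.integral_congr fun u hu => ?_
    rw [Set.uIcc_of_le (by norm_num)] at hu
    simp only [min_eq_left hu.1, max_eq_right hu.1]
    ring
  rw [h1, h2, integral_quintic, integral_quintic]
  norm_num

lemma setIntegral_Icc_fin_two {f : ℝ × ℝ → ℝ} (hf : Continuous f) :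
    ∫ x in Set.Icc (0 : Fin 2 → ℝ) 1, f (x 0, x 1) =
      ∫ s in (0 : ℝ)..1, ∫ t in (0 : ℝ)..1, f (s, t) := by
  have hpre : Set.Icc (0 : Fin 2 → ℝ) 1 =
      MeasurableEquiv.finTwoArrow ⁻¹' (Set.Icc (0 : ℝ) 1 ×ˢ Set.Icc (0 : ℝ) 1) := by
    ext x
    simp only [Set.mem_Icc, Pi.le_def, Fin.forall_fin_two, Pi.zero_apply, Pi.one_apply,
      Set.mem_preimage, MeasurableEquiv.finTwoArrow_apply, Set.mem_prod]
    tauto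
  have h := (volume_preserving_finTwoArrow ℝ).setIntegral_preimage_emb
    MeasurableEquiv.finTwoArrow.measurableEmbedding f (Set.Icc (0 : ℝ) 1 ×ˢ Set.Icc (0 : ℝ) 1)
  rw [← hpre] at h
  refine h.trans ?_
  rw [Measure.volume_eq_prod, setIntegral_prod _
    (hf.continuousOn.integrableOn_compact (isCompact_Icc.prod isCompact_Icc)),
    intervalIntegral.integral_of_le zero_le_one, integral_Icc_eq_integral_Ioc]
  simp_rw [intervalIntegral.integral_of_le zero_le_one, integral_Icc_eq_integral_Ioc]

lemma setIntegral_sqGap {a b h : ℝ} (ha : 0 ≤ a) (hb : 0 ≤ b) (hh : 0 < h)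
    (hah : a + 2 * h ≤ 1) (hbh : b + h ≤ 1) :
    ∫ x in Set.Icc (0 : Fin 2 → ℝ) 1,
        sqGap (max 0 (min 2 ((x 0 - a) / h))) (max 0 (min 1 ((x 1 - b) / h))) =
      2 / 45 * h ^ 2 + 1 / 15 * (1 - (a + 2 * h)) * h - 1 / 5 * (1 - (b + h)) * h := by
  have hcont : Continuous fun z : ℝ × ℝ =>
      sqGap (max 0 (min 2 ((z.1 - a) / h))) (max 0 (min 1 ((z.2 - b) / h))) :=
    continuous_uncurry_sqGap.comp
      (f := fun z : ℝ × ℝ => (max 0 (min 2 ((z.1 - a) / h)), max 0 (min 1 ((z.2 - b) / h))))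
      (by fun_prop)
  rw [setIntegral_Icc_fin_two hcont]
  set r : ℝ → ℝ := fun u => min 1 u ^ 2 + (max 1 u - 1) ^ 2 with hr
  have hrc : Continuous r := by fun_prop
  set z := 1 - (b + h) with hz
  set P : ℝ → ℝ := fun u => 0 + 0 * u + (h / 3 + z) * u ^ 2 + (-z / 2) * u ^ 3 +
    (z / 8 - h / 12) * u ^ 4 + (11 * h / 480) * u ^ 5 with hP
  have hPc : Continuous P := by fun_prop
  have hinner : ∀ s : ℝ, ∫ t in (0 : ℝ)..1,
      sqGap (max 0 (min 2 ((s - a) / h))) (max 0 (min 1 ((t - b) / h))) =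
      (fun u => P u - (h / 3 + z) * r u) (max 0 (min 2 ((s - a) / h))) := by
    intro s
    set u := max 0 (min 2 ((s - a) / h))
    have hu0 : 0 ≤ u := le_max_left _ _
    have hu2 : u ≤ 2 := max_le (by norm_num) (min_le_left _ _)
    rw [integral_comp_clamp (F := sqGap u)
      (continuous_uncurry_sqGap.comp (Continuous.prodMk_right u)) (sqGap_zero_right hu2) hb hh
      zero_le_one (by linarith), integral_sqGap hu0 hu2, sqGap_one hu0]
    simp only [hP, hr, hz]
    ring
  simp_rw [hinner]
  rw [integral_comp_clamp (F := fun u => P u - (h / 3 + z) * r u) (by fun_prop)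
    (by simp [hP, hr]) ha hh (by norm_num) hah,
    intervalIntegral.integral_sub (hPc.intervalIntegrable _ _)
      ((hrc.const_mul _).intervalIntegrable _ _), intervalIntegral.integral_const_mul,
    integral_min_one_sq_add_max_one_sq, integral_quintic]
  simp only [hP, hr]
  norm_num
  ring

end Integration

section NormalizedVolumes

variable {a b h : ℝ}

lemma vol_left_square_inter_Iic (hh : 0 < h) (x : Fin 2 → ℝ) :
    vol (Set.Icc ![a, b] ![a + h, b + h] ∩ Set.Iic x) =
      min 1 (max 0 (min 2 ((x 0 - a) / h))) * max 0 (min 1 ((x 1 - b) / h)) * h ^ 2 := by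
  have h0 := max_zero_min_sub (a := a) (c := 1) (x := x 0) hh
  have h1 := max_zero_min_sub (a := b) (c := 1) (x := x 1) hh
  rw [one_mul] at h0 h1
  have hmin : ∀ u : ℝ, max 0 (min 1 u) = min 1 (max 0 (min 2 u)) := by intro u; grind
  rw [vol_Icc_inter_Iic, h0, h1, hmin ((x 0 - a) / h)]
  ring

lemma vol_right_square_inter_Iic (hh : 0 < h) (x : Fin 2 → ℝ) :
    vol (Set.Icc ![a + h, b] ![a + 2 * h, b + h] ∩ Set.Iic x) =
      (max 1 (max 0 (min 2 ((x 0 - a) / h))) - 1) * max 0 (min 1 ((x 1 - b) / h)) * h ^ 2 := by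
  have h0 := max_zero_min_sub (a := a + h) (c := 1) (x := x 0) hh
  have h1 := max_zero_min_sub (a := b) (c := 1) (x := x 1) hh
  rw [one_mul] at h0 h1
  have he : (x 0 - (a + h)) / h = (x 0 - a) / h - 1 := by field_simp; ring
  have hmin : ∀ u : ℝ, max 0 (min 1 (u - 1)) = max 1 (max 0 (min 2 u)) - 1 := by intro u; grind
  rw [vol_Icc_inter_Iic, h1, show a + 2 * h = a + h + h by ring, h0, he, hmin]
  ring

lemma max_zero_triangle_height (hh : 0 < h) (x : Fin 2 → ℝ) :
    max 0 (min (a + 2 * h) (x 0) / 2 + min (b + h) (x 1) - (a / 2 + b + h)) =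
      h * max 0 (max 0 (min 2 ((x 0 - a) / h)) / 2 + max 0 (min 1 ((x 1 - b) / h)) - 1) := by
  have h0 : min (a + 2 * h) (x 0) = a + h * min 2 ((x 0 - a) / h) := by
    rw [mul_min_of_nonneg _ _ hh.le, mul_div_cancel₀ _ hh.ne', ← min_add_add_left]
    ring_nf
  have h1 : min (b + h) (x 1) = b + h * min 1 ((x 1 - b) / h) := by
    rw [mul_min_of_nonneg _ _ hh.le, mul_div_cancel₀ _ hh.ne', ← min_add_add_left]
    ring_nf
  have hmax : ∀ u v : ℝ, max 0 (min 2 u / 2 + min 1 v - 1) =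
      max 0 (max 0 (min 2 u) / 2 + max 0 (min 1 v) - 1) := by intro u v; grind
  rw [h0, h1, ← hmax, mul_max_of_nonneg _ _ hh.le, mul_zero]
  ring_nf

lemma vol_lower_triangle_inter_Iic (hh : 0 < h) (x : Fin 2 → ℝ) :
    vol (convexHull ℝ {![a, b], ![a + 2 * h, b], ![a, b + h]} ∩ Set.Iic x) =
      (max 0 (min 2 ((x 0 - a) / h)) * max 0 (min 1 ((x 1 - b) / h)) -
        max 0 (max 0 (min 2 ((x 0 - a) / h)) / 2 +
          max 0 (min 1 ((x 1 - b) / h)) - 1) ^ 2) * h ^ 2 := by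
  have h1 := max_zero_min_sub (a := b) (c := 1) (x := x 1) hh
  rw [one_mul] at h1
  rw [vol_triangle_inter_Iic hh, max_zero_triangle_height hh, max_zero_min_sub hh, h1]
  ring

lemma vol_Icc_diff_interior_triangle_inter_Iic' (hh : 0 < h) (x : Fin 2 → ℝ) :
    vol ((Set.Icc ![a, b] ![a + 2 * h, b + h] \
        interior (convexHull ℝ {![a, b], ![a + 2 * h, b], ![a, b + h]})) ∩ Set.Iic x) =
      max 0 (max 0 (min 2 ((x 0 - a) / h)) / 2 +
        max 0 (min 1 ((x 1 - b) / h)) - 1) ^ 2 * h ^ 2 := by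
  rw [vol_Icc_diff_interior_triangle_inter_Iic hh, max_zero_triangle_height hh]
  ring

lemma vol_lower_triangle (hh : 0 < h) :
    vol (convexHull ℝ {![a, b], ![a + 2 * h, b], ![a, b + h]}) = h ^ 2 := by
  have hv := vol_triangle_inter_Iic (a := a) (b := b) hh ![a + 2 * h, b + h]
  rw [Set.inter_eq_left.2] at hv
  · rw [hv]
    simp only [Matrix.cons_val_zero, Matrix.cons_val_one, min_self]
    rw [max_eq_right (by linarith), max_eq_right (by linarith), max_eq_right (by linarith)]
    ring
  · rw [convexHull_right_triangle hh]
    rintro p ⟨h1, h2, h3⟩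
    simp only [Set.mem_Iic, Pi.le_def, Fin.forall_fin_two, Matrix.cons_val_zero,
      Matrix.cons_val_one]
    constructor <;> linarith

lemma vol_Icc_diff_interior_triangle (hh : 0 < h) :
    vol (Set.Icc ![a, b] ![a + 2 * h, b + h] \
      interior (convexHull ℝ {![a, b], ![a + 2 * h, b], ![a, b + h]})) = h ^ 2 := by
  have hv := vol_Icc_diff_interior_triangle_inter_Iic (a := a) (b := b) hh ![a + 2 * h, b + h]
  rw [Set.inter_eq_left.2 fun p hp => hp.1.2] at hv
  rw [hv]
  simp only [Matrix.cons_val_zero, Matrix.cons_val_one, min_self]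
  rw [max_eq_right (by linarith)]
  ring

end NormalizedVolumes

lemma vol_jitteredCube {m : ℕ} (hm : 0 < m) (i : Fin 2 → Fin m) :
    vol (jitteredCube m i) = (1 / (m : ℝ)) ^ 2 := by
  have hm' : (0 : ℝ) < m := by exact_mod_cast hm
  rw [vol, jitteredCube, Real.volume_Icc_pi_toReal]
  · simp only [Fin.prod_univ_two]
    ring
  · intro k
    simp only
    gcongr
    linarith

/-- Replacing the two jittered squares whose union is the rectangle
`I = [1−z₁−2/m, 1−z₁] × [1−z₂−1/m, 1−z₂]` (with `z₁ = j/m`, `z₂ = k/m`) by the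
two triangles changes the mean squared L2-discrepancy by exactly
`(2/45)·m^{−6} + (1/15)·z₁·m^{−5} − (1/5)·z₂·m^{−5}`. -/
theorem jittered_sub_modified_meanL2sq_two_dim (m j k : ℕ) (hm : 2 ≤ m)
    (hj : j ≤ m - 2) (hk : k ≤ m - 1)
    (Ωmod : (Fin 2 → Fin m) → Set (Fin 2 → ℝ))
    (hL : Ωmod (idxL m j k hm hj hk) = tri₁ m j k)
    (hR : Ωmod (idxR m j k hm hj hk) = tri₂ m j k)
    (hrest : ∀ i, i ≠ idxL m j k hm hj hk → i ≠ idxR m j k hm hj hk →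
      Ωmod i = jitteredCube m i) :
    meanL2sq (Set.Icc (0 : Fin 2 → ℝ) 1) (jitteredCube m) -
        meanL2sq (Set.Icc (0 : Fin 2 → ℝ) 1) Ωmod =
      (2 / 45) / (m : ℝ) ^ 6 + (1 / 15) * ((j : ℝ) / m) / (m : ℝ) ^ 5 -
        (1 / 5) * ((k : ℝ) / m) / (m : ℝ) ^ 5 := by
  have hm0 : (0 : ℝ) < m := by exact_mod_cast (by omega : 0 < m)
  set L := idxL m j k hm hj hk with hLdef
  set R := idxR m j k hm hj hk with hRdef
  obtain ⟨h, hh⟩ : ∃ h : ℝ, h = 1 / m := ⟨_, rfl⟩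
  obtain ⟨a, ha⟩ : ∃ a : ℝ, a = 1 - (j : ℝ) / m - 2 / m := ⟨_, rfl⟩
  obtain ⟨b, hb⟩ : ∃ b : ℝ, b = 1 - (k : ℝ) / m - 1 / m := ⟨_, rfl⟩
  have hpos : 0 < h := hh ▸ one_div_pos.2 hm0
  have hjm : (j : ℝ) + 2 ≤ m := by exact_mod_cast (by omega : j + 2 ≤ m)
  have hkm : (k : ℝ) + 1 ≤ m := by exact_mod_cast (by omega : k + 1 ≤ m)
  have ha' : a = ((m : ℝ) - 2 - j) / m := by rw [ha]; field_simp; ring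
  have hb' : b = ((m : ℝ) - 1 - k) / m := by rw [hb]; field_simp; ring
  have ea : 1 - (j : ℝ) / m = a + 2 * h := by rw [ha, hh]; ring
  have eb : 1 - (k : ℝ) / m = b + h := by rw [hb, hh]; ring
  have hLR : L ≠ R := by
    intro he
    have := congrArg Fin.val (congrFun he 0)
    simp [hLdef, hRdef, idxL, idxR] at this
    omega
  have hcL : jitteredCube m L = Set.Icc ![a, b] ![a + h, b + h] := by
    have h0 : ((L 0 : ℕ) : ℝ) = m - 2 - j := by
      simp only [hLdef, idxL, Fin.val_zero, if_true]
      rw [Nat.cast_sub hj, Nat.cast_sub hm, Nat.cast_ofNat]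
    have h1 : ((L 1 : ℕ) : ℝ) = m - 1 - k := by
      simp only [hLdef, idxL, Fin.val_one, one_ne_zero, if_false]
      rw [Nat.cast_sub hk, Nat.cast_sub (by omega), Nat.cast_one]
    unfold jitteredCube
    congr 1 <;> ext i <;> fin_cases i <;>
      simp only [Fin.zero_eta, Fin.mk_one, Matrix.cons_val_zero, Matrix.cons_val_one, h0, h1,
        ha', hb', hh] <;> ring
  have hcR : jitteredCube m R = Set.Icc ![a + h, b] ![a + 2 * h, b + h] := by
    have h0 : ((R 0 : ℕ) : ℝ) = m - 1 - j := by
      simp only [hRdef, idxR, Fin.val_zero, if_true]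
      rw [Nat.cast_sub (by omega), Nat.cast_sub (by omega), Nat.cast_one]
    have h1 : ((R 1 : ℕ) : ℝ) = m - 1 - k := by
      simp only [hRdef, idxR, Fin.val_one, one_ne_zero, if_false]
      rw [Nat.cast_sub hk, Nat.cast_sub (by omega), Nat.cast_one]
    unfold jitteredCube
    congr 1 <;> ext i <;> fin_cases i <;>
      simp only [Fin.zero_eta, Fin.mk_one, Matrix.cons_val_zero, Matrix.cons_val_one, h0, h1,
        ha', hb', hh] <;> ring
  rw [tri₁, ← ha, ← hb, ea, eb] at hL
  rw [tri₂, tri₁, rectI, ← ha, ← hb, ea, eb] at hR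
  have hvJ : ∀ i, vol (jitteredCube m i) = h ^ 2 := fun i => by
    rw [vol_jitteredCube (by omega), hh]
  have hvM : ∀ i, vol (Ωmod i) = h ^ 2 := by
    intro i
    by_cases hiL : i = L
    · rw [hiL, hL, vol_lower_triangle hpos]
    by_cases hiR : i = R
    · rw [hiR, hR, vol_Icc_diff_interior_triangle hpos]
    rw [hrest i hiL hiR, hvJ]
  have hh2 : h ^ 2 ≠ 0 := by positivity
  have hqrest : ∀ i, i ≠ L ∧ i ≠ R → ∀ x, qfun Ωmod i x = qfun (jitteredCube m) i x := by
    intro i hi x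
    rw [qfun, qfun, hrest i hi.1 hi.2]
  set U : (Fin 2 → ℝ) → ℝ := fun x => max 0 (min 2 ((x 0 - a) / h)) with hU
  set V : (Fin 2 → ℝ) → ℝ := fun x => max 0 (min 1 ((x 1 - b) / h)) with hV
  have hJL : ∀ x, qfun (jitteredCube m) L x = min 1 (U x) * V x := fun x => by
    rw [qfun, hvJ, hcL, vol_left_square_inter_Iic hpos, mul_div_cancel_right₀ _ hh2]
  have hJR : ∀ x, qfun (jitteredCube m) R x = (max 1 (U x) - 1) * V x := fun x => by
    rw [qfun, hvJ, hcR, vol_right_square_inter_Iic hpos, mul_div_cancel_right₀ _ hh2]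
  have hML : ∀ x, qfun Ωmod L x = U x * V x - max 0 (U x / 2 + V x - 1) ^ 2 := fun x => by
    rw [qfun, hvM, hL, vol_lower_triangle_inter_Iic hpos, mul_div_cancel_right₀ _ hh2]
  have hMR : ∀ x, qfun Ωmod R x = max 0 (U x / 2 + V x - 1) ^ 2 := fun x => by
    rw [qfun, hvM, hR, vol_Icc_diff_interior_triangle_inter_Iic' hpos,
      mul_div_cancel_right₀ _ hh2]
  have hq : ∀ x, ∑ i, qfun (jitteredCube m) i x = ∑ i, qfun Ωmod i x := by
    intro x
    rw [← sub_eq_zero, ← Finset.sum_sub_distrib, Fintype.sum_eq_add L R hLR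
      fun i hi => by rw [hqrest i hi, sub_self], hJL, hJR, hML, hMR]
    linear_combination V x * min_add_max 1 (U x)
  have hgap : ∀ x, ∑ i, (qfun Ωmod i x ^ 2 - qfun (jitteredCube m) i x ^ 2) =
      sqGap (U x) (V x) := by
    intro x
    rw [Fintype.sum_eq_add L R hLR fun i hi => by rw [hqrest i hi, sub_self], hJL, hJR, hML,
      hMR, sqGap]
    ring
  have hvK : vol (Set.Icc (0 : Fin 2 → ℝ) 1) = 1 := by
    rw [vol, Real.volume_Icc_pi_toReal zero_le_one]
    simp
  rw [meanL2sq_sub_meanL2sq (fun i => by rw [hvJ]; positivity)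
    (fun i => by rw [hvM]; positivity) measurableSet_Icc isCompact_Icc.measure_lt_top.ne hq, hvK]
  simp_rw [hgap]
  rw [integral_div, hU, hV, setIntegral_sqGap (ha' ▸ div_nonneg (by linarith) hm0.le)
    (hb' ▸ div_nonneg (by linarith) hm0.le) hpos
    (by rw [← ea]; exact sub_le_self _ (by positivity))
    (by rw [← eb]; exact sub_le_self _ (by positivity)), ← ea, ← eb, hh]
  simp only [Fintype.card_pi, Fintype.card_fin, Finset.prod_const, Finset.card_univ, Nat.cast_pow]
  field_simp
  ring

end StratifiedSampling
end
end

section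
/- For m ≥ 2 define the index set T_m = {(j,k) : j,k ∈ ℤ, 0 ≤ j ≤ ⌊(m−2)/2⌋, 0 ≤ k ≤ m−1, k/m < 2/(9m) + (2j)/(3m)} and the total gain g_m = Σ_{(j,k) ∈ T_m} [ (2/45)·m^{−6} + (1/15)·(2j/m)·m^{−5} − (1/5)·(k/m)·m^{−5} ]. Then g_m ≤ (1/9)·m^{−3} for all m ≥ 2, and there exist a constant c > 0 and m_0 ∈ ℕ such that g_m ≥ c·m^{−3} for all m ≥ m_0; in particular g_m = Θ(m^{−3}) as m → ∞. -/
noncomputable section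

/-- The total gain `g_m`: the sum over the index set
`T_m = {(j,k) : 0 ≤ j ≤ ⌊(m−2)/2⌋, 0 ≤ k ≤ m−1, k/m < 2/(9m) + 2j/(3m)}`
of the individual improvements
`(2/45)·m^{−6} + (1/15)·(2j/m)·m^{−5} − (1/5)·(k/m)·m^{−5}`. -/
def gain (m : ℕ) : ℝ :=
  ∑ j ∈ Finset.range ((m - 2) / 2 + 1), ∑ k ∈ Finset.range m,
    if (k : ℝ) / m < 2 / (9 * m) + (2 * j : ℝ) / (3 * m) then
      (2 / 45) / (m : ℝ) ^ 6 + (1 / 15) * ((2 * j : ℝ) / m) / (m : ℝ) ^ 5 -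
        (1 / 5) * ((k : ℝ) / m) / (m : ℝ) ^ 5
    else 0

/-- Each summand of `gain` is, up to the factor `1 / (45 m ^ 6)`, the positive part of the
integer `2 + 6 j - 9 k`. -/
theorem gain_eq_sum_max {m : ℕ} (hm : 0 < m) :
    gain m = (∑ j ∈ Finset.range ((m - 2) / 2 + 1), ∑ k ∈ Finset.range m,
      max 0 (2 + 6 * (j : ℝ) - 9 * k)) / (45 * (m : ℝ) ^ 6) := by
  have hm' : (0 : ℝ) < m := by exact_mod_cast hm
  unfold gain
  simp only [Finset.sum_div]
  refine Finset.sum_congr rfl fun j _ => Finset.sum_congr rfl fun k _ => ?_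
  have hiff : (k : ℝ) / m < 2 / (9 * m) + (2 * j : ℝ) / (3 * m) ↔
      0 < 2 + 6 * (j : ℝ) - 9 * k := by
    have heq : 2 / (9 * m) + (2 * j : ℝ) / (3 * m) = ((2 + 6 * j) / 9) / m := by
      field_simp
      ring
    rw [heq, div_lt_div_iff_of_pos_right hm']
    constructor <;> intro h <;> linarith
  split_ifs with h
  · rw [max_eq_right (hiff.1 h).le]
    field_simp
    ring
  · rw [max_eq_left (not_lt.1 (mt hiff.2 h)), zero_div]

theorem cube_le_three_mul_sum_succ_sq (n : ℕ) :
    (n : ℝ) ^ 3 ≤ 3 * ∑ j ∈ Finset.range n, ((j : ℝ) + 1) ^ 2 := by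
  induction n with
  | zero => simp
  | succ n ih =>
    rw [Finset.sum_range_succ]
    push_cast
    nlinarith [(Nat.cast_nonneg n : (0 : ℝ) ≤ n)]

theorem succ_sq_le_sum_max {m j : ℕ} (hj : j < m) :
    2 / 3 * ((j : ℝ) + 1) ^ 2 ≤
      ∑ k ∈ Finset.range m, max 0 (2 + 6 * (j : ℝ) - 9 * k) := by
  have hj0 : (0 : ℝ) ≤ j := j.cast_nonneg
  have hcard : (j : ℝ) + 1 ≤ 3 * ((j / 3 + 1 : ℕ) : ℝ) := by
    exact_mod_cast (by omega : j + 1 ≤ 3 * (j / 3 + 1))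
  calc 2 / 3 * ((j : ℝ) + 1) ^ 2 ≤ ((j / 3 + 1 : ℕ) : ℝ) * (2 + 3 * j) := by nlinarith
    _ = ∑ _k ∈ Finset.range (j / 3 + 1), (2 + 3 * (j : ℝ)) := by
      rw [Finset.sum_const, Finset.card_range, nsmul_eq_mul]
    _ ≤ ∑ k ∈ Finset.range (j / 3 + 1), max 0 (2 + 6 * (j : ℝ) - 9 * k) := by
      refine Finset.sum_le_sum fun k hk => le_max_of_le_right ?_
      have hk' : 3 * k ≤ j := by
        have := Finset.mem_range.1 hk
        omega
      have : 3 * (k : ℝ) ≤ j := by exact_mod_cast hk'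
      linarith
    _ ≤ ∑ k ∈ Finset.range m, max 0 (2 + 6 * (j : ℝ) - 9 * k) :=
      Finset.sum_le_sum_of_subset_of_nonneg (Finset.range_mono (by omega))
        fun _ _ _ => le_max_left _ _

theorem sum_max_le {m : ℕ} (hm : 2 ≤ m) :
    ∑ j ∈ Finset.range ((m - 2) / 2 + 1), ∑ k ∈ Finset.range m,
      max 0 (2 + 6 * (j : ℝ) - 9 * k) ≤ 5 * (m : ℝ) ^ 3 := by
  have hn : (((m - 2) / 2 + 1 : ℕ) : ℝ) ≤ m := by
    exact_mod_cast (by omega : (m - 2) / 2 + 1 ≤ m)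
  calc _ ≤ ∑ _j ∈ Finset.range ((m - 2) / 2 + 1), ∑ _k ∈ Finset.range m, 3 * (m : ℝ) := by
        refine Finset.sum_le_sum fun j hj => Finset.sum_le_sum fun k _ => ?_
        have hj' : 2 + 6 * j ≤ 3 * m := by
          have := Finset.mem_range.1 hj
          omega
        have : 2 + 6 * (j : ℝ) ≤ 3 * m := by exact_mod_cast hj'
        have hk0 : (0 : ℝ) ≤ k := k.cast_nonneg
        exact max_le (by positivity) (by linarith)
    _ = (((m - 2) / 2 + 1 : ℕ) : ℝ) * (m * (3 * m)) := by simp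
    _ ≤ m * (m * (3 * m)) := by gcongr
    _ ≤ 5 * (m : ℝ) ^ 3 := by
      have : (0 : ℝ) ≤ (m : ℝ) ^ 3 := by positivity
      linarith

theorem le_sum_max {m : ℕ} (hm : 2 ≤ m) :
    2 / 243 * (m : ℝ) ^ 3 ≤ ∑ j ∈ Finset.range ((m - 2) / 2 + 1), ∑ k ∈ Finset.range m,
      max 0 (2 + 6 * (j : ℝ) - 9 * k) := by
  have hn : (m : ℝ) ≤ 3 * (((m - 2) / 2 + 1 : ℕ) : ℝ) := by
    exact_mod_cast (by omega : m ≤ 3 * ((m - 2) / 2 + 1))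
  calc 2 / 243 * (m : ℝ) ^ 3 ≤ 2 / 243 * (3 * (((m - 2) / 2 + 1 : ℕ) : ℝ)) ^ 3 := by gcongr
    _ ≤ ∑ j ∈ Finset.range ((m - 2) / 2 + 1), 2 / 3 * ((j : ℝ) + 1) ^ 2 := by
      rw [← Finset.mul_sum, mul_pow]
      linarith [cube_le_three_mul_sum_succ_sq ((m - 2) / 2 + 1)]
    _ ≤ _ := Finset.sum_le_sum fun j hj => succ_sq_le_sum_max (by
      have := Finset.mem_range.1 hj
      omega)

/-- The total gain satisfies `g_m ≤ (1/9)·m^{−3}` for all `m ≥ 2`, and `g_m ≥ c·m^{−3}`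
for some constant `c > 0` and all sufficiently large `m`; in particular
`g_m = Θ(m^{−3})` as `m → ∞`. -/
theorem gain_upper_and_lower_bounds :
    (∀ m : ℕ, 2 ≤ m → gain m ≤ (1 / 9) * ((m : ℝ) ^ 3)⁻¹) ∧
    ∃ c : ℝ, 0 < c ∧ ∃ m₀ : ℕ, ∀ m : ℕ, m₀ ≤ m → c * ((m : ℝ) ^ 3)⁻¹ ≤ gain m := by
  refine ⟨fun m hm => ?_, 2 / 10935, by norm_num, 2, fun m hm => ?_⟩
  · have hm' : (0 : ℝ) < m := by exact_mod_cast (by omega : 0 < m)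
    rw [gain_eq_sum_max (by omega), div_le_iff₀ (by positivity)]
    refine (sum_max_le hm).trans_eq ?_
    field_simp
    norm_num
  · have hm' : (0 : ℝ) < m := by exact_mod_cast (by omega : 0 < m)
    rw [gain_eq_sum_max (by omega), le_div_iff₀ (by positivity)]
    refine Eq.trans_le ?_ (le_sum_max hm)
    field_simp
    norm_num
end
end
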